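/- arXiv:1903.07310 — 3 statements merged into one kernel-verified Lean document; each statement's English description precedes it below -/
import Mathlib

section
/- Let v be a power of a prime p and let h be a positive integer. A (circulant) BH(ℤ_v, h) matrix exists if and only if ν_p(h) ≥ ⌈ν_p(v)/2⌉ and (v, ν_2(h)) ≠ (2, 1), i.e., it is not the case that v = 2 and ν_2(h) = 1. -/
open scoped BigOperators

/-- `H` is a `BH(G, h)` matrix: a `G`-invariant matrix whose entries are complex `h`-th
roots of unity and which satisfies `H * Hᴴ = |G| • I`. -/
def IsBHMatrix {G : Type} [AddCommGroup G] [Fintype G] [DecidableEq G]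
    (H : Matrix G G ℂ) (h : ℕ) : Prop :=
  (∀ g k, H g k ^ h = 1) ∧
  (∀ g k l, H (g + l) (k + l) = H g k) ∧
  H * H.conjTranspose = (Fintype.card G : ℂ) • (1 : Matrix G G ℂ)

/-- A ring automorphism acting trivially modulo every prime containing `m` fixes every
ideal divisor of `m`. -/
lemma Ideal.map_eq_self_of_dvd_span {R : Type*} [CommRing R] [IsDedekindDomain R]
    (σ : R ≃+* R) (m : R)
    (hσ : ∀ P : Ideal R, P.IsPrime → m ∈ P → ∀ x, σ x - x ∈ P) (I : Ideal R)
    (hI : I ∣ Ideal.span {m}) : I.map σ = I := by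
  induction I using UniqueFactorizationMonoid.induction_on_prime with
  | h₁ => simp
  | h₂ J hJ =>
    rw [Ideal.isUnit_iff] at hJ
    rw [hJ, Ideal.map_top]
  | h₃ J P _ hP ih =>
    have hPm : m ∈ P := by
      have : P ∣ Ideal.span {m} := (Dvd.intro _ rfl).trans hI
      exact Ideal.dvd_span_singleton.mp this
    have hP' := Ideal.isPrime_of_prime hP
    have hcomap : P.comap σ = P := by
      ext x
      rw [Ideal.mem_comap]
      have := hσ P hP' hPm x
      exact ⟨fun h ↦ by simpa using P.sub_mem h this, fun h ↦ by simpa using P.add_mem this h⟩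
    have hmap : P.map σ = P := by
      conv_lhs => rw [← hcomap]
      exact Ideal.map_comap_of_surjective (σ : R →+* R) σ.surjective P
    rw [Ideal.map_mul, hmap, ih ((Dvd.intro_left _ rfl).trans hI)]

open NumberField in
/-- An automorphism `ζ ↦ ζ ^ t` of the `M`-th cyclotomic field, with `t ≡ 1` modulo the
`p`-free part of `M`, acts trivially modulo the primes over `p`. -/
lemma IsPrimitiveRoot.ringOfIntegers_aut_sub_mem {M : ℕ} [NeZero M] {K : Type*} [Field K]
    [NumberField K] [IsCyclotomicExtension {M} ℚ K] {ζ : K} (hζ : IsPrimitiveRoot ζ M)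
    {p N t : ℕ} [Fact p.Prime] (ht : M ∣ p ^ N * (t - 1)) (ht1 : 1 ≤ t)
    (σ : 𝓞 K ≃+* 𝓞 K) (hσ : σ hζ.toInteger = hζ.toInteger ^ t)
    (P : Ideal (𝓞 K)) (hP : P.IsPrime) (hpP : (p : 𝓞 K) ∈ P) (x : 𝓞 K) : σ x - x ∈ P := by
  set z := hζ.toInteger with hz
  have hchar : CharP (𝓞 K ⧸ P) p := by
    rw [CharP.charP_iff_prime_eq_zero Fact.out]
    simpa using Ideal.Quotient.eq_zero_iff_mem.2 hpP
  have hzt : z ^ t - z ∈ P := by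
    have hu : (z ^ (t - 1)) ^ p ^ N = 1 := by
      rw [← pow_mul, mul_comm]
      exact (hζ.toInteger_isPrimitiveRoot.pow_eq_one_iff_dvd _).2 ht
    have h1 : Ideal.Quotient.mk P (z ^ (t - 1)) = 1 := by
      have : (Ideal.Quotient.mk P (z ^ (t - 1)) - 1) ^ p ^ N = 0 := by
        rw [sub_pow_char_pow, one_pow, ← map_pow, hu, map_one, sub_self]
      exact sub_eq_zero.1 (pow_eq_zero_iff (pow_ne_zero N (Fact.out : p.Prime).ne_zero) |>.1 this)
    have h2 : z ^ t = z ^ (t - 1) * z := by rw [← pow_succ, Nat.sub_add_cancel ht1]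
    rw [← Ideal.Quotient.eq, h2, map_mul, h1, one_mul]
  have hadj := IsCyclotomicExtension.Rat.adjoin_singleton_eq_top hζ
  have hx : x ∈ Algebra.adjoin ℤ {z} := by rw [hadj]; trivial
  induction hx using Algebra.adjoin_induction with
  | mem y hy => rw [Set.mem_singleton_iff.1 hy, hσ]; exact hzt
  | algebraMap r => simp
  | add a b _ _ ha hb =>
    rw [map_add, add_sub_add_comm]; exact P.add_mem ha hb
  | mul a b _ _ ha hb =>
    have : σ (a * b) - a * b = σ a * (σ b - b) + b * (σ a - a) := by rw [map_mul]; ring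
    rw [this]
    exact P.add_mem (P.mul_mem_left _ hb) (P.mul_mem_left _ ha)

open Polynomial NumberField in
/-- In the `M`-th cyclotomic field with `M` even, an element `F(ζ)` of absolute value `√(p ^ n)`
is multiplied by a root of unity under the automorphisms in the inertia group of `p`. -/
lemma IsPrimitiveRoot.exists_aeval_pow_eq_mul {M : ℕ} [NeZero M] (hM : Even M) {K : Type*}
    [Field K] [NumberField K] [IsCyclotomicExtension {M} ℚ K] {ζ : K} (hζ : IsPrimitiveRoot ζ M)
    {p N n t : ℕ} [Fact p.Prime] (ht : M ∣ p ^ N * (t - 1)) (ht1 : 1 ≤ t) (htM : t.Coprime M)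
    (φ : K →+* ℂ) (F : ℤ[X]) (hF : ‖φ (aeval ζ F)‖ ^ 2 = (p : ℝ) ^ n) :
    ∃ j, aeval (ζ ^ t) F = ζ ^ j * aeval ζ F := by
  have hM0 : M ≠ 0 := NeZero.ne M
  have hconj (ψ : K →+* ℂ) : ψ (aeval ζ F * aeval (ζ ^ (M - 1)) F) = (‖ψ (aeval ζ F)‖ : ℂ) ^ 2 := by
    rw [← Complex.mul_conj', map_mul]
    congr 1
    have h1 : ψ (ζ ^ (M - 1)) = (starRingEnd ℂ) (ψ ζ) := by
      have hψ : ψ ζ ^ M = 1 := by rw [← map_pow, hζ.pow_eq_one, map_one]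
      have hn : ‖ψ ζ‖ = 1 := Complex.norm_eq_one_of_pow_eq_one hψ hM0
      rw [← Complex.inv_eq_conj hn, map_pow]
      refine eq_inv_of_mul_eq_one_left ?_
      rw [← pow_succ, Nat.sub_add_cancel (Nat.pos_of_ne_zero hM0), hψ]
    have h2 (f : K →+* ℂ) (x : K) : f (aeval x F) = aeval (f x) F := by
      simp [aeval_def, hom_eval₂, RingHom.ext_int _ (f.comp (algebraMap ℤ K))]
    rw [h2, h1, h2, aeval_def, aeval_def, hom_eval₂]
    congr 1
    exact RingHom.ext_int _ _
  have hmul : aeval ζ F * aeval (ζ ^ (M - 1)) F = (p : K) ^ n := by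
    apply φ.injective
    rw [hconj, map_pow, map_natCast]
    exact_mod_cast hF
  have hnorm (ψ : K →+* ℂ) : ‖ψ (aeval ζ F)‖ ^ 2 = (p : ℝ) ^ n := by
    have := hconj ψ
    rw [hmul, map_pow, map_natCast] at this
    exact_mod_cast this.symm
  have hp0 : (p : ℝ) ≠ 0 := by exact_mod_cast (Fact.out : p.Prime).ne_zero
  let σ : K ≃ₐ[ℚ] K := (IsCyclotomicExtension.fromZetaAut hζ
      (cyclotomic.irreducible_rat (NeZero.pos M))).symm.trans
    (IsCyclotomicExtension.fromZetaAut (hζ.pow_of_coprime t htM)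
      (cyclotomic.irreducible_rat (NeZero.pos M)))
  have hσ : σ ζ = ζ ^ t := by
    have h1 := IsCyclotomicExtension.fromZetaAut_spec hζ
      (cyclotomic.irreducible_rat (NeZero.pos M))
    have h2 := IsCyclotomicExtension.fromZetaAut_spec (hζ.pow_of_coprime t htM)
      (cyclotomic.irreducible_rat (NeZero.pos M))
    rw [AlgEquiv.trans_apply, (AlgEquiv.symm_apply_eq _).2 h1.symm, h2]
  let τ : 𝓞 K ≃+* 𝓞 K := RingOfIntegers.mapRingEquiv (σ : K ≃+* K)
  have hτ : τ hζ.toInteger = hζ.toInteger ^ t := by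
    apply RingOfIntegers.ext
    change σ ζ = _
    rw [hσ]; rfl
  have hcoe (k : ℕ) : algebraMap (𝓞 K) K (aeval (hζ.toInteger ^ k) F) = aeval (ζ ^ k) F := by
    rw [← aeval_algebraMap_apply, map_pow]; rfl
  set A : 𝓞 K := aeval hζ.toInteger F with hA
  have hAK : algebraMap (𝓞 K) K A = aeval ζ F := by simpa using hcoe 1
  have hτA : algebraMap (𝓞 K) K (τ A) = aeval (ζ ^ t) F := by
    change σ (algebraMap (𝓞 K) K A) = _
    rw [hAK, ← hσ]
    exact (aeval_algHom_apply ((σ : K →ₐ[ℚ] K).restrictScalars ℤ) ζ F).symm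
  have hdvd : Ideal.span {A} ∣ Ideal.span {((p : 𝓞 K)) ^ n} := by
    rw [Ideal.dvd_span_singleton, Ideal.mem_span_singleton]
    refine ⟨aeval (hζ.toInteger ^ (M - 1)) F, ?_⟩
    have h : algebraMap (𝓞 K) K (A * aeval (hζ.toInteger ^ (M - 1)) F) = (p : K) ^ n := by
      rw [map_mul, hAK, hcoe, hmul]
    apply FaithfulSMul.algebraMap_injective (𝓞 K) K
    rw [h, map_pow, map_natCast]
  have hmap := Ideal.map_eq_self_of_dvd_span τ _ (fun P hP hpP x ↦
    hζ.ringOfIntegers_aut_sub_mem ht ht1 τ hτ P hP (hP.mem_of_pow_mem _ hpP) x) _ hdvd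
  rw [Ideal.map_span, Set.image_singleton, Ideal.span_singleton_eq_span_singleton] at hmap
  obtain ⟨u, hu⟩ := hmap.symm
  have huK : aeval ζ F * algebraMap (𝓞 K) K u = aeval (ζ ^ t) F := by
    rw [← hAK, ← hτA, ← map_mul]
    exact congrArg _ hu
  have hutors : u ∈ Units.torsion K := by
    rw [Units.mem_torsion]
    intro w
    obtain ⟨ψ, rfl⟩ := w.mk_embedding ▸ (⟨w.embedding, rfl⟩ :
      ∃ ψ : K →+* ℂ, InfinitePlace.mk ψ = InfinitePlace.mk w.embedding)
    rw [InfinitePlace.apply]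
    have h1 := hnorm ψ
    have h2 := hnorm (ψ.comp (σ : K →+* K))
    have h3 : (ψ.comp (σ : K →+* K)) (aeval ζ F) = ψ (aeval ζ F) * ψ (algebraMap (𝓞 K) K u) := by
      rw [← map_mul, huK, ← hτA, ← hAK]
      rfl
    rw [h3, norm_mul, mul_pow, h1] at h2
    have h4 : ‖ψ (algebraMap (𝓞 K) K u)‖ ^ 2 = 1 := by
      have : (p : ℝ) ^ n ≠ 0 := pow_ne_zero _ hp0
      field_simp at h2
      exact h2
    exact (pow_eq_one_iff_of_nonneg (norm_nonneg _) two_ne_zero).1 h4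
  have huM : algebraMap (𝓞 K) K u ^ M = 1 := by
    rw [← Units.rootsOfUnity_eq_torsion, IsCyclotomicExtension.Rat.torsionOrder_eq (n := M),
      if_pos hM, mem_rootsOfUnity'] at hutors
    rw [← map_pow, hutors, map_one]
  obtain ⟨j, -, hj⟩ := hζ.eq_pow_of_pow_eq_one huM
  exact ⟨j, by rw [← huK, ← hj, mul_comm]⟩

open Polynomial in
/-- An integral polynomial relation for a primitive root of unity holds for its conjugates. -/
lemma IsPrimitiveRoot.aeval_pow_eq_zero {M t : ℕ} (hM : 0 < M) {ζ : ℂ} (hζ : IsPrimitiveRoot ζ M)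
    (ht : t.Coprime M) (F : ℤ[X]) (hF : aeval ζ F = 0) : aeval (ζ ^ t) F = 0 := by
  have hdvd : cyclotomic M ℤ ∣ F := by
    rw [cyclotomic_eq_minpoly hζ hM]
    exact minpoly.isIntegrallyClosed_dvd (hζ.isIntegral hM) hF
  obtain ⟨G, rfl⟩ := hdvd
  have : aeval (ζ ^ t) (cyclotomic M ℤ) = 0 := by
    rw [cyclotomic_eq_minpoly (hζ.pow_of_coprime t ht) hM]
    exact minpoly.aeval _ _
  rw [map_mul, this, zero_mul]

open Polynomial in
/-- A primitive root of unity in a cyclotomic field embeds as any complex one. -/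
lemma IsPrimitiveRoot.exists_algHom_apply_eq {M : ℕ} [NeZero M] {K : Type*} [Field K] [NumberField K]
    [IsCyclotomicExtension {M} ℚ K] {z : K} (hz : IsPrimitiveRoot z M) {ζ : ℂ}
    (hζ : IsPrimitiveRoot ζ M) : ∃ φ : K →ₐ[ℚ] ℂ, φ z = ζ := by
  have hirr := cyclotomic.irreducible_rat (NeZero.pos M)
  have h0 : aeval ζ (minpoly ℚ (hz.powerBasis ℚ).gen) = 0 := by
    rw [IsPrimitiveRoot.powerBasis_gen ℚ hz, ← hz.minpoly_eq_cyclotomic_of_irreducible hirr,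
      cyclotomic_eq_minpoly_rat hζ (NeZero.pos M)]
    exact minpoly.aeval _ _
  refine ⟨(hz.powerBasis ℚ).lift ζ h0, ?_⟩
  have := (hz.powerBasis ℚ).lift_gen ζ h0
  rwa [IsPrimitiveRoot.powerBasis_gen ℚ hz] at this

open Polynomial in
/-- If a sum of powers of `ζ` has absolute value `√(p ^ n)`, then it is multiplied by a root of
unity when `ζ` is replaced by `ζ ^ t`, where `t ≡ 1` modulo the `p`-free part of `M`. -/
lemma IsPrimitiveRoot.exists_sum_pow_eq_mul {M : ℕ} (hM0 : 0 < M) (hM : Even M) {ζ : ℂ}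
    (hζ : IsPrimitiveRoot ζ M) {p N n t : ℕ} (hp : p.Prime) (ht : M ∣ p ^ N * (t - 1))
    (ht1 : 1 ≤ t) (htM : t.Coprime M) {ι : Type*} (S : Finset ι) (c : ι → ℕ)
    (hS : ‖∑ x ∈ S, ζ ^ c x‖ ^ 2 = (p : ℝ) ^ n) :
    ∃ j, ∀ s, s.Coprime M → ∑ x ∈ S, ζ ^ (s * t * c x) = ζ ^ (s * j) * ∑ x ∈ S, ζ ^ (s * c x) := by
  have : NeZero M := ⟨hM0.ne'⟩
  have : Fact p.Prime := ⟨hp⟩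
  let F : ℤ[X] := ∑ x ∈ S, X ^ c x
  have h0 : ∃ j, aeval (ζ ^ t) F = ζ ^ j * aeval ζ F := by
    suffices h : ∀ (K : Type) [Field K] [NumberField K] [IsCyclotomicExtension {M} ℚ K],
        ∃ j, aeval (ζ ^ t) F = ζ ^ j * aeval ζ F from by
      have : NeZero (M : ℚ) := ⟨Nat.cast_ne_zero.2 hM0.ne'⟩
      have hK := CyclotomicField.isCyclotomicExtension M ℚ
      exact @h (CyclotomicField M ℚ) _ _ hK
    intro K _ _ _
    have hz := IsCyclotomicExtension.zeta_spec M ℚ K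
    set z := IsCyclotomicExtension.zeta M ℚ K
    obtain ⟨φ, hφ⟩ := hz.exists_algHom_apply_eq hζ
    have hφF (x : K) : φ (aeval x F) = aeval (φ x) F := by simp [F]
    obtain ⟨j, hj⟩ := hz.exists_aeval_pow_eq_mul hM ht ht1 htM (φ : K →+* ℂ) F (n := n) (by
      rw [← hS, RingHom.coe_coe, hφF, hφ]
      simp [F])
    refine ⟨j, ?_⟩
    have := congrArg φ hj
    rwa [map_mul, hφF, hφF, map_pow, map_pow, hφ] at this
  obtain ⟨j, hj⟩ := h0
  refine ⟨j, fun s hs ↦ ?_⟩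
  have := hζ.aeval_pow_eq_zero hM0 hs
    (∑ x ∈ S, X ^ (t * c x) - X ^ j * F) (by
      rw [map_sub, map_mul, ← sub_eq_zero.2 hj]
      simp [F, pow_mul])
  simpa [F, sub_eq_zero, ← pow_mul, mul_assoc] using this

lemma geom_sum_eq_zero_of_pow_eq_one {R : Type*} [Ring R] [NoZeroDivisors R] {x : R} {n : ℕ}
    (hx : x ^ n = 1) (hx1 : x ≠ 1) : ∑ i ∈ Finset.range n, x ^ i = 0 := by
  have := mul_geom_sum x n
  rw [hx, sub_self] at this
  exact (mul_eq_zero.1 this).resolve_left (sub_ne_zero.2 hx1)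

lemma IsPrimitiveRoot.pow_eq_pow_iff_modEq {R : Type*} [CommMonoid R] {ζ : R} {k : ℕ}
    (hζ : IsPrimitiveRoot ζ k) (hk : 0 < k) {a b : ℕ} : ζ ^ a = ζ ^ b ↔ a ≡ b [MOD k] := by
  have := (hζ.isOfFinOrder hk.ne').pow_eq_pow_iff_modEq (n := a) (m := b)
  rwa [← hζ.eq_orderOf] at this

lemma coprime_one_add_mul_div {M p : ℕ} (hp : p.Prime) (hpM : p ^ 2 ∣ M) (i : ℕ) :
    (1 + i * (M / p)).Coprime M := by
  refine Nat.Coprime.symm (Nat.coprime_of_dvd fun q hq hqM hq1 ↦ ?_)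
  obtain ⟨m, rfl⟩ := hpM
  rw [show p ^ 2 * m = p * (p * m) by ring] at hqM hq1
  rw [Nat.mul_div_cancel_left _ hp.pos] at hq1
  have hq2 : q ∣ p * m := by
    rcases (Nat.Prime.dvd_mul hq).1 hqM with h | h
    · exact h.mul_right _
    · exact h
  exact hq.one_lt.ne' (Nat.dvd_one.1 ((Nat.dvd_add_left (hq2.mul_left i)).1 hq1))

/-- If a sum of powers of a primitive `M`-th root of unity has absolute value `√(p ^ n)` and
`p ^ 2 ∣ M` (`8 ∣ M` if `p = 2`), then only the exponents in one class modulo `p` contribute. -/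
lemma IsPrimitiveRoot.exists_sum_pow_eq_sum_filter_modEq_prime {M : ℕ} (hM0 : 0 < M) (hM : Even M)
    {ζ : ℂ} (hζ : IsPrimitiveRoot ζ M) {p n : ℕ} (hp : p.Prime) (hpM : p ^ 2 ∣ M)
    (h2M : p = 2 → 8 ∣ M) {ι : Type*} (S : Finset ι) (c : ι → ℕ)
    (hS : ‖∑ x ∈ S, ζ ^ c x‖ ^ 2 = (p : ℝ) ^ n) :
    ∃ y, ∑ x ∈ S, ζ ^ c x = ∑ x ∈ S with c x ≡ y [MOD p], ζ ^ c x := by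
  set m := M / p with hm
  have hMm : M = p * m := (Nat.mul_div_cancel' ((dvd_pow_self p two_ne_zero).trans hpM)).symm
  have hpm : p ∣ m := by
    rw [hMm, sq] at hpM
    exact Nat.dvd_of_mul_dvd_mul_left hp.pos hpM
  have hζ0 : ζ ≠ 0 := hζ.ne_zero hM0.ne'
  have hζM := hζ.pow_eq_one
  have hω : IsPrimitiveRoot (ζ ^ m) p := hζ.pow hM0 (by rw [hMm, mul_comm])
  set ω := ζ ^ m with hωdef
  have hω0 : ω ≠ 0 := pow_ne_zero _ hζ0
  obtain ⟨j, hj⟩ := hζ.exists_sum_pow_eq_mul hM0 hM hp (N := 1) (t := 1 + 1 * m) (by simp [hMm])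
    (by omega) (coprime_one_add_mul_div hp hpM 1) S c hS
  set G : ℕ → ℂ := fun i ↦ ∑ x ∈ S, ζ ^ c x * (ω ^ c x) ^ i with hG
  have hG0 : G 0 = ∑ x ∈ S, ζ ^ c x := by simp [hG]
  have hGne : G 0 ≠ 0 := by
    intro h
    rw [← hG0, h] at hS
    have : (p : ℝ) ^ n ≠ 0 := pow_ne_zero _ (by exact_mod_cast hp.ne_zero)
    simp at hS
    exact this hS.symm
  have hGs (i : ℕ) : ∑ x ∈ S, ζ ^ ((1 + i * m) * c x) = G i := by
    refine Finset.sum_congr rfl fun x _ ↦ ?_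
    rw [hωdef, ← pow_mul, ← pow_mul, ← pow_add]
    congr 1; ring
  have hGstep (i : ℕ) : G (i + 1) = ζ ^ j * (ω ^ j) ^ i * G i := by
    have h := hj (1 + i * m) (coprime_one_add_mul_div hp hpM i)
    rw [hGs, show ζ ^ ((1 + i * m) * j) = ζ ^ j * (ω ^ j) ^ i by
      rw [hωdef, ← pow_mul, ← pow_mul, ← pow_add]; congr 1; ring] at h
    rw [← h, ← hGs]
    refine Finset.sum_congr rfl fun x _ ↦ ?_
    obtain ⟨d, hd⟩ := hpm
    have : (1 + i * m) * (1 + 1 * m) * c x = (1 + (i + 1) * m) * c x + M * (d * i * c x) := by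
      rw [hMm]
      conv_rhs => rw [show p * m * (d * i * c x) = (p * d) * m * (i * c x) by ring, ← hd]
      ring
    rw [this, pow_add, pow_mul _ M, hζM, one_pow, mul_one]
  have hGprod (i : ℕ) : G i = (∏ l ∈ Finset.range i, ζ ^ j * (ω ^ j) ^ l) * G 0 := by
    induction i with
    | zero => simp
    | succ i ih => rw [hGstep, Finset.prod_range_succ, ih]; ring
  have hGp : G p = G 0 := by
    refine Finset.sum_congr rfl fun x _ ↦ ?_
    rw [pow_right_comm, hω.pow_eq_one, one_pow, pow_zero]
  have hprod : ∏ l ∈ Finset.range p, ζ ^ j * (ω ^ j) ^ l = 1 := by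
    have := hGprod p
    rw [hGp] at this
    exact mul_right_cancel₀ hGne (by rw [← this, one_mul])
  rw [Finset.prod_mul_distrib, Finset.prod_const, Finset.card_range, Finset.prod_pow_eq_pow_sum]
    at hprod
  have hηp : (ζ ^ j) ^ p = 1 := by
    rcases hp.eq_two_or_odd' with rfl | hodd
    · obtain ⟨d, hd⟩ := h2M rfl
      have hm4 : m = 4 * d := by omega
      simp only [Finset.sum_range_succ, Finset.sum_range_zero, zero_add, pow_one, hωdef] at hprod
      have h1 : ζ ^ (2 * j + m * j) = 1 := by
        rw [← hprod, ← pow_mul, ← pow_mul, ← pow_add]; congr 1; ring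
      have h2 : ζ ^ ((2 * j + m * j) * (1 + 2 * d)) = 1 := by rw [pow_mul, h1, one_pow]
      rw [show (2 * j + m * j) * (1 + 2 * d) = j * 2 + M * (j + d * j) by rw [hd, hm4]; ring,
        pow_add, pow_mul _ M, hζM, one_pow, mul_one, pow_mul] at h2
      exact h2
    · obtain ⟨r, hr⟩ := hodd
      have hsum : ∑ l ∈ Finset.range p, l = p * r := by
        rw [Finset.sum_range_id, hr, Nat.add_sub_cancel, mul_comm 2 r, ← mul_assoc,
          Nat.mul_div_cancel _ two_pos]
      rw [hsum, pow_mul, pow_right_comm ω, hω.pow_eq_one, one_pow, one_pow, mul_one] at hprod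
      exact hprod
  obtain ⟨y, hy⟩ : m ∣ j := by
    rw [← pow_mul, hζ.pow_eq_one_iff_dvd, hMm, mul_comm] at hηp
    exact Nat.dvd_of_mul_dvd_mul_right hp.pos hηp
  have hη : ζ ^ j = ω ^ y := by rw [hy, pow_mul]
  have hωj : ω ^ j = 1 := by
    rw [hω.pow_eq_one_iff_dvd, hy]; exact hpm.mul_right _
  have hGi (i : ℕ) : G i = (ω ^ y) ^ i * G 0 := by
    rw [hGprod]; simp [hωj, hη]
  refine ⟨y, ?_⟩
  have hp0 : (p : ℂ) ≠ 0 := by exact_mod_cast hp.ne_zero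
  have key : ∑ i ∈ Finset.range p, ((ω ^ y) ^ i)⁻¹ * G i =
      p * ∑ x ∈ S with c x ≡ y [MOD p], ζ ^ c x := by
    simp only [hG, Finset.mul_sum]
    rw [Finset.sum_comm, Finset.sum_filter]
    refine Finset.sum_congr rfl fun x _ ↦ ?_
    have h1 : ∀ i, ((ω ^ y) ^ i)⁻¹ * (ζ ^ c x * (ω ^ c x) ^ i) =
        ζ ^ c x * (ω ^ c x / ω ^ y) ^ i := fun i ↦ by rw [div_pow]; ring
    simp only [h1, ← Finset.mul_sum]
    split_ifs with hc
    · have : ω ^ c x = ω ^ y := by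
        rwa [hω.pow_eq_pow_iff_modEq hp.pos]
      simp [this, div_self (pow_ne_zero y hω0), mul_comm]
    · rw [geom_sum_eq_zero_of_pow_eq_one, mul_zero]
      · rw [div_pow, pow_right_comm, hω.pow_eq_one, one_pow, pow_right_comm, hω.pow_eq_one,
          one_pow, div_one]
      · rw [Ne, div_eq_one_iff_eq (pow_ne_zero y hω0), hω.pow_eq_pow_iff_modEq hp.pos]
        exact hc
  rw [← mul_right_inj' hp0, ← key, ← hG0]
  have h1 : ∀ i, ((ω ^ y) ^ i)⁻¹ * G i = G 0 := fun i ↦ by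
    rw [hGi]
    exact inv_mul_cancel_left₀ (pow_ne_zero _ (pow_ne_zero _ hω0)) _
  rw [Finset.sum_congr rfl fun i _ ↦ h1 i]
  simp

/-- If a sum of powers of a primitive `M`-th root of unity has absolute value `√(p ^ n)` and
`p ^ (j + 1) ∣ M` (`2 ^ (j + 2) ∣ M` if `p = 2`), then only the exponents in one class
modulo `p ^ j` contribute. -/
lemma IsPrimitiveRoot.exists_sum_pow_eq_sum_filter_modEq {p : ℕ} (hp : p.Prime) {n : ℕ} (j : ℕ)
    {M : ℕ} (hM0 : 0 < M) (hM : Even M) {ζ : ℂ} (hζ : IsPrimitiveRoot ζ M)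
    (hpM : p ^ (j + 1) ∣ M) (h2M : p = 2 → 2 ^ (j + 2) ∣ M) {ι : Type*} (S : Finset ι) (c : ι → ℕ)
    (hS : ‖∑ x ∈ S, ζ ^ c x‖ ^ 2 = (p : ℝ) ^ n) :
    ∃ y, ∑ x ∈ S, ζ ^ c x = ∑ x ∈ S with c x ≡ y [MOD p ^ j], ζ ^ c x := by
  induction j generalizing M ζ S c with
  | zero => exact ⟨0, by simp [Nat.modEq_one]⟩
  | succ j ih =>
    obtain ⟨y, hy⟩ := hζ.exists_sum_pow_eq_sum_filter_modEq_prime hM0 hM hp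
      ((pow_dvd_pow p (by omega)).trans hpM)
      (fun h ↦ (pow_dvd_pow 2 (show 3 ≤ j + 1 + 2 by omega)).trans (h2M h)) S c hS
    set T := S.filter fun x ↦ c x ≡ y [MOD p]
    have hT (f : ι → Prop) [DecidablePred f] : ∑ x ∈ T with f x, ζ ^ c x =
        ζ ^ (y % p) * ∑ x ∈ T with f x, (ζ ^ p) ^ (c x / p) := by
      rw [Finset.mul_sum]
      refine Finset.sum_congr rfl fun x hx ↦ ?_
      have : c x % p = y % p := (Finset.mem_filter.1 (Finset.mem_filter.1 hx).1).2
      rw [← pow_mul, ← pow_add, ← this, Nat.mod_add_div]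
    have hT' : ∑ x ∈ T, ζ ^ c x = ζ ^ (y % p) * ∑ x ∈ T, (ζ ^ p) ^ (c x / p) := by
      simpa using hT fun _ ↦ True
    obtain ⟨m, rfl⟩ : p ∣ M := (dvd_pow_self p (by omega)).trans hpM
    have hm0 : 0 < m := Nat.pos_of_mul_pos_left hM0
    have hpm : p ^ (j + 1) ∣ m := by
      rw [pow_succ'] at hpM
      exact Nat.dvd_of_mul_dvd_mul_left hp.pos hpM
    have h2m : p = 2 → 2 ^ (j + 2) ∣ m := by
      rintro rfl
      have := h2M rfl
      rw [show j + 1 + 2 = (j + 2) + 1 by ring, pow_succ'] at this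
      exact Nat.dvd_of_mul_dvd_mul_left two_pos this
    have hm : Even m := by
      rcases hp.eq_two_or_odd' with rfl | hodd
      · exact even_iff_two_dvd.2 ((dvd_pow_self 2 (by omega)).trans (h2m rfl))
      · exact (Nat.even_mul.1 hM).resolve_left (Nat.not_even_iff_odd.2 hodd)
    have hn : ‖ζ‖ = 1 := Complex.norm_eq_one_of_pow_eq_one hζ.pow_eq_one hM0.ne'
    obtain ⟨z, hz⟩ := ih hm0 hm (hζ.pow hM0 rfl) hpm h2m T (fun x ↦ c x / p) (by
      rw [← hS, hy, hT', norm_mul, norm_pow, hn, one_pow, one_mul])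
    refine ⟨y % p + p * z, ?_⟩
    rw [hy, hT', hz, ← hT, Finset.filter_filter]
    refine Finset.sum_congr (Finset.filter_congr fun x _ ↦ ?_) fun _ _ ↦ rfl
    have hyp : (y % p + p * z) % p = y % p := by simp
    constructor
    · rintro ⟨h1, h2⟩
      have h1' : c x % p = y % p := h1
      rw [← Nat.mod_add_div (c x) p, h1', pow_succ']
      exact (Nat.ModEq.mul_left' p h2).add_left _
    · intro h
      have h1 : c x % p = y % p := by
        rw [← hyp]
        exact h.of_dvd (dvd_pow_self p (by omega))
      refine ⟨h1, ?_⟩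
      rw [← Nat.mod_add_div (c x) p, h1, pow_succ'] at h
      exact Nat.ModEq.mul_left_cancel' hp.ne_zero (Nat.ModEq.add_left_cancel' _ h)

open ComplexConjugate in
/-- A `BH(G, h)` matrix is the same as a sequence of `h`-th roots of unity indexed by `G` with
vanishing autocorrelations. -/
lemma exists_isBHMatrix_iff {G : Type} [AddCommGroup G] [Fintype G] [DecidableEq G] {h : ℕ}
    (hh : h ≠ 0) : (∃ H : Matrix G G ℂ, IsBHMatrix H h) ↔
      ∃ a : G → ℂ, (∀ x, a x ^ h = 1) ∧ ∀ τ, τ ≠ 0 → ∑ x, a x * conj (a (x + τ)) = 0 := by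
  constructor
  · rintro ⟨H, h1, h2, h3⟩
    refine ⟨H 0, h1 0, fun τ hτ ↦ ?_⟩
    have := congrFun (congrFun h3 0) (-τ)
    rw [Matrix.mul_apply, Matrix.smul_apply, Matrix.one_apply_ne (by simpa [eq_comm] using hτ),
      smul_zero] at this
    rw [← this]
    refine Finset.sum_congr rfl fun x _ ↦ ?_
    have := h2 (-τ) x τ
    rw [neg_add_cancel] at this
    rw [this, Matrix.conjTranspose_apply]
    rfl
  · rintro ⟨a, h1, h2⟩
    refine ⟨Matrix.of fun g k ↦ a (k - g), fun g k ↦ h1 _, fun g k l ↦ by simp, ?_⟩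
    ext g g'
    have key : ∑ x, a (x - g) * conj (a (x - g')) = ∑ x, a x * conj (a (x + (g - g'))) := by
      refine Fintype.sum_equiv (Equiv.subRight g) _ _ fun x ↦ ?_
      simp
    rw [Matrix.mul_apply]
    simp only [Matrix.conjTranspose_apply, Matrix.of_apply, Matrix.smul_apply]
    refine key.trans ?_
    rcases eq_or_ne g g' with rfl | hg
    · have : ∀ x, a x * conj (a x) = 1 := fun x ↦ by
        rw [Complex.mul_conj, Complex.normSq_eq_norm_sq,
          Complex.norm_eq_one_of_pow_eq_one (h1 x) hh]
        simp
      simp [this]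
    · rw [h2 _ (sub_ne_zero.2 hg), Matrix.one_apply_ne hg, smul_zero]

lemma ZMod.sum_val_eq_sum_range {R : Type*} [AddCommMonoid R] (v : ℕ) [NeZero v] (f : ℕ → R) :
    ∑ x : ZMod v, f x.val = ∑ i ∈ Finset.range v, f i := by
  refine Finset.sum_nbij' ZMod.val Nat.cast ?_ ?_ ?_ ?_ ?_
  · exact fun x _ ↦ Finset.mem_range.2 x.val_lt
  · simp
  · simp
  · exact fun i hi ↦ ZMod.val_cast_of_lt (Finset.mem_range.1 hi)
  · simp

lemma Finset.sum_range_mul_eq_sum_sum {R : Type*} [AddCommMonoid R] (k N : ℕ) (f : ℕ → R) :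
    ∑ x ∈ Finset.range (k * N), f x =
      ∑ q ∈ Finset.range k, ∑ r ∈ Finset.range N, f (q * N + r) := by
  induction k with
  | zero => simp
  | succ k ih => rw [add_mul, one_mul, Finset.sum_range_add, Finset.sum_range_succ, ih]

section Construction

variable {b N : ℕ} {θ ω : ℂ}

open ComplexConjugate in
lemma sum_range_autocorrelation_eq_zero (hb : 0 < b) (hN : 0 < N) (hω : IsPrimitiveRoot ω (b * N))
    (hθ : IsPrimitiveRoot (θ ^ 2) b) (hθ1 : ‖θ‖ = 1) {τ : ℕ} (hτ : ¬ b * N * N ∣ τ) :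
    ∑ x ∈ Finset.range (b * N * N), (θ ^ (x / N) ^ 2 * ω ^ (x / N * (x % N))) *
      conj (θ ^ ((x + τ) / N) ^ 2 * ω ^ ((x + τ) / N * ((x + τ) % N))) = 0 := by
  have hbN : 0 < b * N := Nat.mul_pos hb hN
  have hω1 : ‖ω‖ = 1 := Complex.norm_eq_one_of_pow_eq_one hω.pow_eq_one hbN.ne'
  have hω0 : ω ≠ 0 := hω.ne_zero hbN.ne'
  have hθ0 : θ ≠ 0 := fun h ↦ by simp [h] at hθ1
  have hθω : (θ ^ 2) ^ (b * N) = 1 := by rw [pow_mul, hθ.pow_eq_one, one_pow]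
  rw [Finset.sum_range_mul_eq_sum_sum, Finset.sum_comm]
  set C : ℕ → ℕ := fun r ↦ τ / N + (r + τ % N) / N
  set D : ℕ → ℕ := fun r ↦ (r + τ % N) % N
  have hterm (q r : ℕ) (hr : r ∈ Finset.range N) :
      (θ ^ ((q * N + r) / N) ^ 2 * ω ^ ((q * N + r) / N * ((q * N + r) % N))) *
      conj (θ ^ ((q * N + r + τ) / N) ^ 2 * ω ^ ((q * N + r + τ) / N * ((q * N + r + τ) % N))) =
      (θ ^ C r ^ 2 * ω ^ (C r * D r))⁻¹ * (ω ^ r / ((θ ^ 2) ^ C r * ω ^ D r)) ^ q := by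
    have hr' := Finset.mem_range.1 hr
    have e0 : q * N + r + τ = (r + τ % N) + N * (q + τ / N) := by
      conv_lhs => rw [← Nat.mod_add_div τ N]
      ring
    have e1 : (q * N + r + τ) / N = q + C r := by
      rw [e0, Nat.add_mul_div_left _ _ hN]; simp only [C]; ring
    have e2 : (q * N + r + τ) % N = D r := by
      rw [e0, Nat.add_mul_mod_self_left]
    have e3 : (q * N + r) / N = q := by
      rw [add_comm, Nat.add_mul_div_right _ _ hN, Nat.div_eq_of_lt hr', zero_add]
    have e4 : (q * N + r) % N = r := by
      rw [add_comm, Nat.add_mul_mod_self_right, Nat.mod_eq_of_lt hr']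
    have f1 : θ ^ (q + C r) ^ 2 = θ ^ q ^ 2 * ((θ ^ 2) ^ C r) ^ q * θ ^ C r ^ 2 := by ring
    have f2 : ω ^ ((q + C r) * D r) = (ω ^ D r) ^ q * ω ^ (C r * D r) := by ring
    have f3 : ω ^ (q * r) = (ω ^ r) ^ q := by ring
    rw [e1, e2, e3, e4, ← Complex.inv_eq_conj (by simp [hω1, hθ1]), f1, f2, f3, div_pow, mul_pow]
    have g1 := pow_ne_zero (q ^ 2) hθ0
    have g2 := pow_ne_zero q (pow_ne_zero (C r) (pow_ne_zero 2 hθ0))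
    have g3 := pow_ne_zero (C r ^ 2) hθ0
    have g4 := pow_ne_zero q (pow_ne_zero (D r) hω0)
    have g5 := pow_ne_zero (C r * D r) hω0
    generalize θ ^ q ^ 2 = A1 at *
    generalize ((θ ^ 2) ^ C r) ^ q = A2 at *
    generalize θ ^ C r ^ 2 = A3 at *
    generalize (ω ^ D r) ^ q = A4 at *
    generalize ω ^ (C r * D r) = A5 at *
    field_simp
  rw [Finset.sum_congr rfl fun r hr ↦ Finset.sum_congr rfl fun q _ ↦ hterm q r hr]
  simp only [← Finset.mul_sum]
  have hρ (r : ℕ) : (ω ^ r / ((θ ^ 2) ^ C r * ω ^ D r)) ^ (b * N) = 1 := by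
    rw [div_pow, mul_pow, pow_right_comm, hω.pow_eq_one, one_pow, pow_right_comm, hθω, one_pow,
      pow_right_comm, hω.pow_eq_one, one_pow, one_mul, div_one]
  by_cases hd : τ % N = 0
  · have hC (r) (hr : r ∈ Finset.range N) : C r = τ / N := by
      simp [C, hd, Nat.div_eq_of_lt (Finset.mem_range.1 hr)]
    have hD (r) (hr : r ∈ Finset.range N) : D r = r := by
      simp [D, hd, Nat.mod_eq_of_lt (Finset.mem_range.1 hr)]
    by_cases hc : b ∣ τ / N
    · have hc1 : (θ ^ 2) ^ (τ / N) = 1 := (hθ.pow_eq_one_iff_dvd _).2 hc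
      have hterm2 (r) (hr : r ∈ Finset.range N) : (θ ^ C r ^ 2 * ω ^ (C r * D r))⁻¹ *
          ∑ q ∈ Finset.range (b * N), (ω ^ r / ((θ ^ 2) ^ C r * ω ^ D r)) ^ q =
          (θ ^ (τ / N) ^ 2)⁻¹ * (b * N) * ((ω ^ (τ / N))⁻¹) ^ r := by
        rw [hC r hr, hD r hr, hc1, one_mul, div_self (pow_ne_zero _ hω0)]
        simp only [one_pow, Finset.sum_const, Finset.card_range, nsmul_eq_mul, mul_one]
        rw [mul_inv, inv_pow, ← pow_mul]
        push_cast
        ring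
      rw [Finset.sum_congr rfl hterm2, ← Finset.mul_sum, geom_sum_eq_zero_of_pow_eq_one, mul_zero]
      · rw [inv_pow, inv_eq_one, ← pow_mul, hω.pow_eq_one_iff_dvd]
        exact Nat.mul_dvd_mul_right hc N
      · rw [Ne, inv_eq_one, hω.pow_eq_one_iff_dvd]
        intro h
        apply hτ
        rw [← Nat.div_mul_cancel (Nat.dvd_of_mod_eq_zero hd)]
        exact Nat.mul_dvd_mul_right h N
    · refine Finset.sum_eq_zero fun r hr ↦ ?_
      rw [geom_sum_eq_zero_of_pow_eq_one (hρ r), mul_zero]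
      rw [hC r hr, hD r hr, div_mul_cancel_right₀ (pow_ne_zero _ hω0), Ne, inv_eq_one,
        hθ.pow_eq_one_iff_dvd]
      exact hc
  · refine Finset.sum_eq_zero fun r hr ↦ ?_
    rw [geom_sum_eq_zero_of_pow_eq_one (hρ r), mul_zero]
    intro h
    rw [div_eq_one_iff_eq (by simp [hω0, hθ0])] at h
    have h' := congrArg (· ^ b) h
    simp only [mul_pow] at h'
    rw [pow_right_comm _ (C r), hθ.pow_eq_one, one_pow, one_mul, ← pow_mul, ← pow_mul,
      hω.pow_eq_pow_iff_modEq hbN, mul_comm r, mul_comm (D r)] at h'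
    have h2 : r ≡ r + τ % N [MOD N] :=
      (Nat.ModEq.mul_left_cancel' hb.ne' h').trans (Nat.mod_modEq _ _)
    have h3 : N ∣ τ % N := by simpa using (Nat.modEq_iff_dvd' (by omega)).1 h2
    exact hd (Nat.eq_zero_of_dvd_of_lt h3 (Nat.mod_lt _ hN))

lemma exists_isBHMatrix_of_isPrimitiveRoot {v : ℕ} [NeZero v] (hv : v = b * N * N) {h : ℕ}
    (hh : h ≠ 0) (hω : IsPrimitiveRoot ω (b * N)) (hθ : IsPrimitiveRoot (θ ^ 2) b)
    (hθb : θ ^ b ^ 2 = 1) (hθh : θ ^ h = 1) (hωh : b * N ∣ h) :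
    ∃ H : Matrix (ZMod v) (ZMod v) ℂ, IsBHMatrix H h := by
  subst hv
  have hv := NeZero.ne (b * N * N)
  have hN : 0 < N := Nat.pos_of_ne_zero fun h ↦ by simp [h] at hv
  have hb : 0 < b := Nat.pos_of_ne_zero fun h ↦ by simp [h] at hv
  rw [exists_isBHMatrix_iff hh]
  set S : ℕ → ℂ := fun x ↦ θ ^ (x / N) ^ 2 * ω ^ (x / N * (x % N)) with hS
  have hper : Function.Periodic S (b * N * N) := fun x ↦ by
    simp only [hS]
    rw [Nat.add_mul_div_right _ _ hN, Nat.add_mul_mod_self_right,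
      show (x / N + b * N) ^ 2 = (x / N) ^ 2 + 2 * b * (N * (x / N)) + b ^ 2 * N ^ 2 by ring,
      pow_add, pow_add, pow_mul _ (b ^ 2), hθb, pow_mul _ (2 * b), pow_mul _ 2 b, hθ.pow_eq_one,
      add_mul, pow_add ω, pow_mul ω (b * N), hω.pow_eq_one]
    simp
  refine ⟨fun x ↦ S x.val, fun x ↦ ?_, fun τ hτ ↦ ?_⟩
  · simp only [hS]
    obtain ⟨e, rfl⟩ := hωh
    rw [mul_pow, pow_right_comm, hθh, one_pow, pow_right_comm, pow_mul ω (b * N), hω.pow_eq_one]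
    simp
  · have h1 : ∀ x : ZMod (b * N * N), S (x + τ).val = S (x.val + τ.val) := fun x ↦ by
      rw [ZMod.val_add, hper.map_mod_nat]
    simp only [h1]
    rw [ZMod.sum_val_eq_sum_range _ fun i ↦ S i * (starRingEnd ℂ) (S (i + τ.val))]
    refine sum_range_autocorrelation_eq_zero hb hN hω hθ
      (Complex.norm_eq_one_of_pow_eq_one hθh hh) fun h ↦ hτ ?_
    rw [← ZMod.val_eq_zero]
    exact Nat.eq_zero_of_dvd_of_lt h τ.val_lt

end Construction

lemma exists_isBHMatrix_of_valuation {p n h : ℕ} (hp : p.Prime) (hh : h ≠ 0) [NeZero (p ^ n)]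
    (hn : (n + 1) / 2 ≤ padicValNat p h) (h2 : ¬(p ^ n = 2 ∧ padicValNat 2 h = 1)) :
    ∃ H : Matrix (ZMod (p ^ n)) (ZMod (p ^ n)) ℂ, IsBHMatrix H h := by
  have := Fact.mk hp
  have hdvd {k : ℕ} (hk : k ≤ padicValNat p h) : p ^ k ∣ h :=
    (padicValNat_dvd_iff_le hh).2 hk
  obtain ⟨m, rfl | rfl⟩ := Nat.even_or_odd' n
  · have e : p ^ (2 * m) = 1 * p ^ m * p ^ m := by ring
    have hω := Complex.isPrimitiveRoot_exp (1 * p ^ m) (by simp [hp.ne_zero])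
    exact exists_isBHMatrix_of_isPrimitiveRoot (θ := 1) e hh hω (by simp) (by simp) (by simp)
      (by rw [one_mul]; exact hdvd (by omega))
  · have e : p ^ (2 * m + 1) = p * p ^ m * p ^ m := by ring
    have hω := Complex.isPrimitiveRoot_exp (p * p ^ m) (by simp [hp.ne_zero])
    have hωh : p * p ^ m ∣ h := by rw [← pow_succ']; exact hdvd (by omega)
    obtain ⟨θ, hθ, hθb, hθh⟩ : ∃ θ : ℂ, IsPrimitiveRoot (θ ^ 2) p ∧ θ ^ p ^ 2 = 1 ∧ θ ^ h = 1 := by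
      rcases hp.eq_two_or_odd' with rfl | hodd
      · refine ⟨Complex.I, by simpa using IsPrimitiveRoot.neg_one 0 two_ne_zero.symm,
          by norm_num, ?_⟩
        have h4 : 2 ^ 2 ∣ h := by
          refine hdvd ?_
          by_contra hlt
          have hm : m = 0 := by omega
          subst hm
          exact h2 ⟨by norm_num, by omega⟩
        obtain ⟨e, rfl⟩ := h4
        rw [pow_mul]
        norm_num
      · have hθ := Complex.isPrimitiveRoot_exp p hp.ne_zero
        refine ⟨_, hθ.pow_of_coprime 2 hodd.coprime_two_left, ?_, ?_⟩
        · rw [sq, pow_mul, hθ.pow_eq_one, one_pow]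
        · exact (hθ.pow_eq_one_iff_dvd _).2 ((dvd_mul_right _ _).trans hωh)
    exact exists_isBHMatrix_of_isPrimitiveRoot e hh hω hθ hθb hθh hωh

open ComplexConjugate in
lemma norm_sq_sum_mul_addChar {G : Type*} [AddCommGroup G] [Fintype G] {a : G → ℂ}
    (ha : ∀ x, ‖a x‖ = 1) (hac : ∀ τ, τ ≠ 0 → ∑ x, a x * conj (a (x + τ)) = 0)
    (ψ : AddChar G ℂ) : ‖∑ x, a x * ψ x‖ ^ 2 = Fintype.card G := by
  classical
  have hψ (x : G) : ψ x * conj (ψ x) = 1 := by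
    rw [Complex.mul_conj, Complex.normSq_eq_norm_sq, ψ.norm_apply]
    simp
  have h1 : ((‖∑ x, a x * ψ x‖ ^ 2 : ℝ) : ℂ) = (Fintype.card G : ℝ) := by
    rw [← Complex.normSq_eq_norm_sq, ← Complex.mul_conj, map_sum, Finset.sum_mul_sum]
    have h2 (x : G) : ∑ y, a x * ψ x * conj (a y * ψ y) =
        ∑ τ, a x * conj (a (x + τ)) * conj (ψ τ) := by
      refine Fintype.sum_equiv (Equiv.subRight x) _ _ fun y ↦ ?_
      have h3 : ψ y = ψ x * ψ (y - x) := by rw [← ψ.map_add_eq_mul, add_sub_cancel]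
      rw [Equiv.subRight_apply, add_sub_cancel, map_mul, h3, map_mul]
      linear_combination a x * conj (a y) * conj (ψ (y - x)) * hψ x
    simp only [h2]
    rw [Finset.sum_comm]
    simp only [← Finset.sum_mul]
    rw [Finset.sum_eq_single 0 (fun τ _ hτ ↦ by rw [hac τ hτ, zero_mul]) (by simp)]
    have h4 (x : G) : a x * conj (a x) = 1 := by
      rw [Complex.mul_conj, Complex.normSq_eq_norm_sq, ha]
      simp
    simp [h4]
  exact_mod_cast h1

lemma IsPrimitiveRoot.exists_pow_eq_of_pow_eq_one {ζ z : ℂ} {p n k w : ℕ} (hp : 0 < p)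
    (hw : 0 < w) (hζ : IsPrimitiveRoot ζ (p ^ n * w)) (hk : k ≤ n) (hz : z ^ (p ^ k * w) = 1) :
    ∃ e, p ^ (n - k) ∣ e ∧ ζ ^ e = z := by
  have h1 : IsPrimitiveRoot (ζ ^ p ^ (n - k)) (p ^ k * w) := by
    refine hζ.pow (by positivity) ?_
    rw [← mul_assoc, ← pow_add, Nat.sub_add_cancel hk]
  have : NeZero (p ^ k * w) := ⟨by positivity⟩
  obtain ⟨i, -, hi⟩ := h1.eq_pow_of_pow_eq_one hz
  exact ⟨p ^ (n - k) * i, dvd_mul_right _ _, by rw [pow_mul, hi]⟩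

lemma ZMod.card_le_of_val_modEq {p n j : ℕ} (hp : 0 < p) (hj : j ≤ n) (S : Finset (ZMod (p ^ n)))
    (hS : ∀ x ∈ S, ∀ y ∈ S, x.val ≡ y.val [MOD p ^ j]) : S.card ≤ p ^ (n - j) := by
  have : NeZero (p ^ n) := ⟨by positivity⟩
  rw [← Finset.card_range (p ^ (n - j))]
  refine Finset.card_le_card_of_injOn (fun x ↦ x.val / p ^ j) (fun x _ ↦ ?_) fun x hx y hy hxy ↦ ?_
  · rw [Finset.mem_coe, Finset.mem_range, Nat.div_lt_iff_lt_mul (by positivity), ← pow_add,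
      Nat.sub_add_cancel hj]
    exact x.val_lt
  · apply ZMod.val_injective
    rw [← Nat.mod_add_div x.val (p ^ j), ← Nat.mod_add_div y.val (p ^ j), hS x hx y hy]
    simp only at hxy
    rw [hxy]

lemma eq_of_card_le_norm_sum {ι : Type*} {S : Finset ι} {z : ι → ℂ} (hz : ∀ i ∈ S, ‖z i‖ = 1)
    (hS : (S.card : ℝ) ≤ ‖∑ i ∈ S, z i‖) {i j : ι} (hi : i ∈ S) (hj : j ∈ S) : z i = z j := by
  set s := ∑ i ∈ S, z i with hs
  have hs0 : 0 < ‖s‖ := lt_of_lt_of_le (by exact_mod_cast Finset.card_pos.2 ⟨i, hi⟩) hS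
  have hsC : (‖s‖ : ℂ) ≠ 0 := by exact_mod_cast hs0.ne'
  set u := (starRingEnd ℂ) s / ‖s‖ with hu
  have hu1 : ‖u‖ = 1 := by
    rw [hu, norm_div, RCLike.norm_conj, Complex.norm_real, norm_norm, div_self hs0.ne']
  have hre : ∀ i ∈ S, (z i * u).re ≤ 1 := fun i hi ↦ by
    refine (Complex.re_le_norm _).trans ?_
    rw [norm_mul, hz i hi, hu1, one_mul]
  have hsum : ∑ i ∈ S, (z i * u).re = ‖s‖ := by
    have h1 : s * u = ‖s‖ := by
      rw [hu, ← mul_div_assoc, Complex.mul_conj, Complex.normSq_eq_norm_sq, div_eq_iff hsC]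
      push_cast
      ring
    rw [← Complex.re_sum, ← Finset.sum_mul, ← hs, h1, Complex.ofReal_re]
  have heq : ∀ i ∈ S, (z i * u).re = 1 := by
    refine (Finset.sum_eq_sum_iff_of_le hre).1 (le_antisymm (Finset.sum_le_sum hre) ?_)
    rw [hsum]
    simpa using hS
  have hone : ∀ i ∈ S, z i * u = 1 := fun i hi ↦ by
    have h1 : ‖z i * u‖ = 1 := by rw [norm_mul, hz i hi, hu1, one_mul]
    have h2 := Complex.sq_norm (z i * u)
    rw [Complex.normSq_apply, h1, heq i hi] at h2
    refine Complex.ext (heq i hi) ?_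
    simpa using h2
  have hu0 : u ≠ 0 := fun h ↦ by simp [h] at hu1
  exact mul_right_cancel₀ hu0 ((hone i hi).trans (hone j hj).symm)

/-- The bound on `n` obtained from a single character sum of a circulant Butson matrix. -/
lemma le_two_mul_of_norm_sq_sum_eq {p n w k m : ℕ} (hp : p.Prime) (hw : 0 < w)
    (hpw : p.Coprime w) (hM : Even (p ^ n * w)) {ζ : ℂ} (hζ : IsPrimitiveRoot ζ (p ^ n * w))
    [NeZero (p ^ n)] (hkm : k ≤ m) (hmn : m ≤ n) (hm : 1 ≤ m) (hm2 : p = 2 → 2 ≤ m)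
    {e : ZMod (p ^ n) → ℕ} (he : ∀ x, p ^ (n - k) ∣ e x)
    (hS : ‖∑ x, ζ ^ (e x + w * x.val)‖ ^ 2 = (p : ℝ) ^ n) : n ≤ 2 * m ∧ (k < m → n ≠ 2 * m) := by
  have hM0 : 0 < p ^ n * w := Nat.mul_pos (pow_pos hp.pos n) hw
  have hp1 : (1 : ℝ) < p := by exact_mod_cast hp.one_lt
  obtain ⟨y, hy⟩ := hζ.exists_sum_pow_eq_sum_filter_modEq hp (n - m) hM0 hM
    ((pow_dvd_pow p (by omega)).mul_right w)
    (fun h ↦ h ▸ (pow_dvd_pow p (by have := hm2 h; omega)).mul_right w) _ _ hS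
  set T := Finset.univ.filter fun x : ZMod (p ^ n) ↦ e x + w * x.val ≡ y [MOD p ^ (n - m)]
  rw [hy] at hS
  have hζ1 : ‖ζ‖ = 1 := Complex.norm_eq_one_of_pow_eq_one hζ.pow_eq_one hM0.ne'
  have hcancel {j : ℕ} (hj : j ≤ n - k) (x x' : ZMod (p ^ n))
      (h : e x + w * x.val ≡ e x' + w * x'.val [MOD p ^ j]) : x.val ≡ x'.val [MOD p ^ j] := by
    have h0 (x) : e x ≡ 0 [MOD p ^ j] :=
      (Nat.modEq_zero_iff_dvd).2 ((pow_dvd_pow p hj).trans (he x))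
    refine Nat.ModEq.cancel_left_of_coprime (c := w) (Nat.Coprime.pow_left j hpw) ?_
    exact Nat.ModEq.add_left_cancel ((h0 x).trans (h0 x').symm) h
  have hcard : T.card ≤ p ^ m := by
    have := ZMod.card_le_of_val_modEq hp.pos (show n - m ≤ n by omega) T fun x hx x' hx' ↦
      hcancel (by omega) x x' ((Finset.mem_filter.1 hx).2.trans (Finset.mem_filter.1 hx').2.symm)
    rwa [Nat.sub_sub_self hmn] at this
  have hcard' : (T.card : ℝ) ≤ (p : ℝ) ^ m := by exact_mod_cast hcard
  have hnorm : ‖∑ x ∈ T, ζ ^ (e x + w * x.val)‖ ≤ T.card := by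
    refine (norm_sum_le _ _).trans ?_
    simp [hζ1]
  refine ⟨?_, fun hlt hn ↦ ?_⟩
  · rw [← pow_le_pow_iff_right₀ hp1, ← hS, mul_comm, pow_mul]
    gcongr
    exact hnorm.trans hcard'
  · have hpn : (p : ℝ) ^ n = ((p : ℝ) ^ m) ^ 2 := by rw [← pow_mul, mul_comm, hn]
    rw [hpn, sq_eq_sq₀ (norm_nonneg _) (by positivity)] at hS
    have hlt' := Nat.pow_lt_pow_right hp.one_lt hlt
    have hge : (T.card : ℝ) ≤ ‖∑ x ∈ T, ζ ^ (e x + w * x.val)‖ := hS ▸ hcard'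
    have hle := ZMod.card_le_of_val_modEq hp.pos (show n - k ≤ n by omega) T fun x hx x' hx' ↦ by
      refine hcancel le_rfl x x' ?_
      have := eq_of_card_le_norm_sum (fun i _ ↦ by simp [hζ1]) hge hx hx'
      rw [hζ.pow_eq_pow_iff_modEq hM0] at this
      exact this.of_dvd ((pow_dvd_pow p (by omega)).mul_right w)
    rw [Nat.sub_sub_self (by omega)] at hle
    have : (p : ℝ) ^ m ≤ T.card := hS ▸ hnorm
    have : p ^ m ≤ T.card := by exact_mod_cast this
    omega

section PrimeOrder

variable {p : ℕ} [Fact p.Prime] {a : ZMod p → ℂ}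

lemma AddChar.sum_sum_mulShift_eq {ψ : AddChar (ZMod p) ℂ} (hψ : ψ.IsPrimitive)
    (a : ZMod p → ℂ) (z : ZMod p) : ∑ s, (∑ x, a x * ψ (s * x)) * ψ (-(s * z)) = p * a z := by
  have h1 (s : ZMod p) : (∑ x, a x * ψ (s * x)) * ψ (-(s * z)) =
      ∑ x, a x * ψ (s * (x - z)) := by
    rw [Finset.sum_mul]
    refine Finset.sum_congr rfl fun x _ ↦ ?_
    rw [mul_assoc, ← ψ.map_add_eq_mul]
    congr 2
    ring
  simp only [h1]
  rw [Finset.sum_comm]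
  simp only [← Finset.mul_sum, AddChar.sum_mulShift _ hψ, sub_eq_zero, ZMod.card]
  simp [mul_comm]

open ComplexConjugate in
/-- A sequence over `ZMod p` with vanishing autocorrelations cannot be constant off zero, unless
it involves third roots of unity. -/
lemma three_dvd_of_forall_ne_zero_eq (hp : p ≠ 2) {w : ℕ} (hw : w ≠ 0) (ha : ∀ x, a x ^ w = 1)
    (hac : ∀ τ, τ ≠ 0 → ∑ x, a x * conj (a (x + τ)) = 0) {b : ℂ} (hb : ∀ z, z ≠ 0 → a z = b) :
    p = 3 ∧ 3 ∣ w := by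
  have hp' : p.Prime := Fact.out
  have hb1 : a 1 = b := hb 1 one_ne_zero
  have hn (x) : ‖a x‖ = 1 := Complex.norm_eq_one_of_pow_eq_one (ha x) hw
  have hself (x) : a x * conj (a x) = 1 := by
    rw [Complex.mul_conj, Complex.normSq_eq_norm_sq, hn]
    simp
  have hterm (x : ZMod p) : a x * conj (a (x + 1)) = 1 + (if x = 0 then a 0 * conj b - 1 else 0) +
      (if x = -1 then b * conj (a 0) - 1 else 0) := by
    by_cases h0 : x = 0
    · subst h0
      rw [if_pos rfl, if_neg (by simp), zero_add, hb1]
      ring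
    · by_cases h1 : x = -1
      · subst h1
        rw [if_neg h0, if_pos rfl, neg_add_cancel, hb _ h0]
        ring
      · rw [if_neg h0, if_neg h1, hb x h0, hb (x + 1) (fun h ↦ h1 (eq_neg_of_add_eq_zero_left h)),
          ← hb1, hself]
        ring
  have hsum := hac 1 one_ne_zero
  simp only [hterm, Finset.sum_add_distrib, Finset.sum_ite_eq', Finset.mem_univ, if_true,
    Finset.sum_const, Finset.card_univ, ZMod.card, nsmul_eq_mul, mul_one] at hsum
  set z := a 0 * conj b with hz
  have hz' : conj z = b * conj (a 0) := by rw [hz, map_mul, Complex.conj_conj, mul_comm]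
  have hzz : z * conj z = 1 := by
    rw [hz', hz]
    have h1 := hself 1
    rw [hb1] at h1
    linear_combination a 0 * conj (a 0) * h1 + hself 0
  have hnz : ‖z‖ = 1 := by rw [hz, norm_mul, RCLike.norm_conj, hn, ← hb1, hn, one_mul]
  rw [← hz'] at hsum
  have hp3 : p = 3 := by
    have h1 := congrArg Complex.re hsum
    simp only [Complex.add_re, Complex.sub_re, Complex.natCast_re, Complex.one_re, Complex.conj_re,
      Complex.zero_re] at h1
    have h2 := (abs_le.1 (Complex.abs_re_le_norm z)).1
    rw [hnz] at h2
    have h3 : (p : ℝ) ≤ 4 := by linarith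
    have h4 : p ≤ 4 := by exact_mod_cast h3
    have := hp'.two_le
    have h5 : p ≠ 4 := by
      rintro rfl
      norm_num at hp'
    omega
  refine ⟨hp3, ?_⟩
  subst hp3
  have hz3 : z ^ 3 = 1 := by
    push_cast at hsum
    linear_combination (z ^ 2 - z) * hsum - (z - 1) * hzz
  have hz1 : z ≠ 1 := by
    rintro h
    rw [h, map_one] at hsum
    norm_num at hsum
  have hzw : z ^ w = 1 := by
    rw [hz, ← hb1, mul_pow, ← map_pow, ha, ha, map_one, one_mul]
  rw [← orderOf_eq_prime hz3 hz1]
  exact orderOf_dvd_of_pow_eq_one hzw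

open ComplexConjugate in
lemma eq_three_of_sum_mulShift_eq_mul (hp : p ≠ 2) {w : ℕ} (hw : w ≠ 0) (ha : ∀ x, a x ^ w = 1)
    (hac : ∀ τ, τ ≠ 0 → ∑ x, a x * conj (a (x + τ)) = 0)
    {ψ : AddChar (ZMod p) ℂ} (hψ : ψ.IsPrimitive) {g : (ZMod p)ˣ}
    (hg : ∀ x, x ∈ Subgroup.zpowers g) {ε : ℂ}
    (hf : ∀ s, s ≠ 0 → ∑ x, a x * ψ (g * s * x) = ε * ∑ x, a x * ψ (s * x)) : p = 3 ∧ 3 ∣ w := by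
  have hp' : p.Prime := Fact.out
  set f : ZMod p → ℂ := fun s ↦ ∑ x, a x * ψ (s * x) with hfdef
  have hf' (s) (hs : s ≠ 0) : f (g * s) = ε * f s := hf s hs
  have hpC : (p : ℂ) ≠ 0 := by exact_mod_cast hp'.ne_zero
  have hsplit (F : ZMod p → ℂ) : ∑ s, F s = F 0 + ∑ s with s ≠ 0, F s := by
    rw [← Finset.sum_erase_add _ _ (Finset.mem_univ 0), add_comm]
    congr 1
    refine Finset.sum_congr (by ext; simp) fun _ _ ↦ rfl
  have hn (x) : ‖a x‖ = 1 := Complex.norm_eq_one_of_pow_eq_one (ha x) hw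
  by_cases hε : ε = 1
  · have hpow (i : ℕ) : f ((g ^ i : (ZMod p)ˣ) : ZMod p) = f 1 := by
      induction i with
      | zero => simp
      | succ i ih => rw [pow_succ', Units.val_mul, hf' _ (Units.ne_zero _), ih, hε, one_mul]
    have hconst (s) (hs : s ≠ 0) : f s = f 1 := by
      obtain ⟨i, hi⟩ := (mem_powers_iff_mem_zpowers.2 (hg (Units.mk0 s hs)))
      simp only at hi
      rw [← hpow i, hi, Units.val_mk0]
    refine three_dvd_of_forall_ne_zero_eq (b := (f 0 - f 1) / p) hp hw ha hac fun z hz ↦ ?_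
    rw [eq_div_iff hpC, mul_comm, ← AddChar.sum_sum_mulShift_eq hψ a z]
    have h1 := AddChar.sum_mulShift (-z) hψ
    rw [if_neg (neg_ne_zero.2 hz), hsplit] at h1
    simp only [mul_neg] at h1
    rw [zero_mul, neg_zero, ψ.map_zero_eq_one, Nat.cast_zero] at h1
    rw [hsplit]
    change f 0 * ψ (-(0 * z)) + ∑ s with s ≠ 0, f s * ψ (-(s * z)) = f 0 - f 1
    rw [Finset.sum_congr rfl fun s hs ↦ by rw [hconst s (Finset.mem_filter.1 hs).2],
      ← Finset.mul_sum, zero_mul, neg_zero, ψ.map_zero_eq_one]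
    linear_combination f 1 * h1
  · exfalso
    have h0 : ∑ s with s ≠ 0, f s = 0 := by
      have h1 : ∑ s with s ≠ 0, f s = ∑ s with s ≠ 0, f (g * s) :=
        (Finset.sum_equiv g.mulLeft (by simp) (by simp)).symm
      rw [Finset.sum_congr rfl fun s hs ↦ hf' s (Finset.mem_filter.1 hs).2, ← Finset.mul_sum] at h1
      have h2 : (1 - ε) * ∑ s with s ≠ 0, f s = 0 := by linear_combination h1
      exact (mul_eq_zero.1 h2).resolve_left (sub_ne_zero.2 (Ne.symm hε))
    have h1 := AddChar.sum_sum_mulShift_eq hψ a 0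
    simp only [mul_zero, neg_zero, ψ.map_zero_eq_one, mul_one] at h1
    rw [hsplit, h0, add_zero] at h1
    have h2 := norm_sq_sum_mul_addChar hn hac 1
    simp only [zero_mul, ψ.map_zero_eq_one, mul_one, AddChar.one_apply, ZMod.card] at h1 h2
    rw [h1, norm_mul, hn, mul_one, Complex.norm_natCast, sq] at h2
    have h3 : p * p = p * 1 := by rw [mul_one]; exact_mod_cast h2
    exact hp'.one_lt.ne' (Nat.eq_of_mul_eq_mul_left hp'.pos h3)

open ComplexConjugate in
lemma dvd_of_autocorrelation_eq_zero (hp : p ≠ 2) {w : ℕ} (hw : w ≠ 0) (ha : ∀ x, a x ^ w = 1)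
    (hac : ∀ τ, τ ≠ 0 → ∑ x, a x * conj (a (x + τ)) = 0) : p ∣ w := by
  have hp' : p.Prime := Fact.out
  by_contra hpw
  have hpw' : p.Coprime (2 * w) :=
    (hp'.odd_of_ne_two hp).coprime_two_right.mul_right (hp'.coprime_iff_not_dvd.2 hpw)
  set W := 2 * w with hW
  have hW0 : 0 < W := by positivity
  have hM0 : 0 < p * W := Nat.mul_pos hp'.pos hW0
  have hζ := Complex.isPrimitiveRoot_exp (p * W) hM0.ne'
  set ζ := Complex.exp (2 * Real.pi * Complex.I / ((p * W : ℕ) : ℂ))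
  have hmod {i j : ℕ} (h1 : i ≡ j [MOD p]) (h2 : i ≡ j [MOD W]) : ζ ^ i = ζ ^ j :=
    (hζ.pow_eq_pow_iff_modEq hM0).2 ((Nat.modEq_and_modEq_iff_modEq_mul hpw').1 ⟨h1, h2⟩)
  have hω : IsPrimitiveRoot (ζ ^ W) p := hζ.pow hM0 (mul_comm _ _)
  set ψ := AddChar.zmodChar p hω.pow_eq_one
  have hψ : ψ.IsPrimitive := AddChar.zmodChar_primitive_of_primitive_root p hω
  have hψn (i : ℕ) : ψ (i : ZMod p) = ζ ^ (W * i) := by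
    rw [AddChar.zmodChar_apply']
    exact (pow_mul _ _ _).symm
  have he (x : ZMod p) : ∃ e, p ∣ e ∧ ζ ^ e = a x := by
    have hζ' : IsPrimitiveRoot ζ (p ^ 1 * W) := by rwa [pow_one]
    simpa using hζ'.exists_pow_eq_of_pow_eq_one (k := 0) hp'.pos hW0 zero_le_one
      (z := a x) (by rw [pow_zero, one_mul, hW, mul_comm, pow_mul, ha, one_pow])
  choose e he hea using he
  obtain ⟨g, hg⟩ := IsCyclic.exists_generator (α := (ZMod p)ˣ)
  obtain ⟨t, ht1, ht2⟩ := Nat.chineseRemainder hpw' (g : ZMod p).val 1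
  have ht : (t : ZMod p) = g := by
    rw [(ZMod.natCast_eq_natCast_iff _ _ _).2 ht1, ZMod.natCast_zmod_val]
  have hcop {s : ℕ} (hs : s ≡ 1 [MOD W]) (hs0 : (s : ZMod p) ≠ 0) : s.Coprime (p * W) := by
    refine Nat.Coprime.mul_right ?_ ?_
    · rw [Nat.coprime_comm, hp'.coprime_iff_not_dvd, ← ZMod.natCast_eq_zero_iff]
      exact hs0
    · rw [Nat.Coprime, hs.gcd_eq, Nat.gcd_one_left]
  have ht0 : 1 ≤ t := by
    rw [Nat.one_le_iff_ne_zero]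
    rintro rfl
    have := g.ne_zero
    rw [← ht] at this
    simp at this
  have hsum {s : ℕ} (hs : s ≡ 1 [MOD W]) :
      ∑ x, ζ ^ (s * (e x + W * x.val)) = ∑ x, a x * ψ (s * x) := by
    refine Finset.sum_congr rfl fun x _ ↦ ?_
    have h1 : ψ (s * x) = ζ ^ (W * (s * x.val)) := by
      rw [← hψn]
      push_cast
      rw [ZMod.natCast_zmod_val]
    have h2 : ζ ^ (s * e x) = ζ ^ e x := hmod
      ((Nat.modEq_zero_iff_dvd.2 ((he x).mul_left s)).trans (Nat.modEq_zero_iff_dvd.2 (he x)).symm)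
      (by simpa using hs.mul_right (e x))
    rw [h1, ← hea, ← h2, ← pow_add]
    congr 1
    ring
  have hS : ‖∑ x, ζ ^ (e x + W * x.val)‖ ^ 2 = (p : ℝ) ^ 1 := by
    have h1 := hsum (Nat.ModEq.refl 1)
    simp only [one_mul, Nat.cast_one] at h1
    rw [h1, norm_sq_sum_mul_addChar (fun x ↦ Complex.norm_eq_one_of_pow_eq_one (ha x) hw) hac,
      ZMod.card, pow_one]
  obtain ⟨j, hj⟩ := hζ.exists_sum_pow_eq_mul hM0 (even_two_mul w |>.mul_left p) hp' (N := 1) (t := t)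
    (by rw [pow_one]; exact Nat.mul_dvd_mul_left p ((Nat.modEq_iff_dvd' ht0).1 ht2.symm)) ht0
    (hcop ht2 (ht ▸ g.ne_zero)) _ _ hS
  have hWp : (W : ZMod p) ≠ 0 := by
    rw [Ne, ZMod.natCast_eq_zero_iff, ← hp'.coprime_iff_not_dvd]
    exact hpw'
  set d : ZMod p := j / W with hd
  have hζ0 : ζ ≠ 0 := hζ.ne_zero hM0.ne'
  have hequi (s : ZMod p) (hs : s ≠ 0) : ∑ x, a x * ψ (g * s * x) =
      (ζ ^ j / ψ d) * ψ (d * s) * ∑ x, a x * ψ (s * x) := by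
    obtain ⟨s', h1, h2⟩ := Nat.chineseRemainder hpw' s.val 1
    have hs' : (s' : ZMod p) = s := by
      rw [(ZMod.natCast_eq_natCast_iff _ _ _).2 h1, ZMod.natCast_zmod_val]
    have h3 := hj s' (hcop h2 (hs' ▸ hs))
    rw [hsum (s := s' * t) (by simpa using h2.mul ht2), hsum h2] at h3
    push_cast at h3
    rw [hs', ht, mul_comm s] at h3
    rw [h3]
    congr 1
    have hdn : d = (d.val : ZMod p) := (ZMod.natCast_zmod_val d).symm
    have h4 : ψ (d * s) = ζ ^ (W * (d.val * s')) := by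
      rw [← hψn]
      push_cast
      rw [hs', ← hdn]
    have h5 : ψ d = ζ ^ (W * d.val) := by rw [← hψn, ← hdn]
    rw [h4, h5, div_mul_eq_mul_div, eq_div_iff (pow_ne_zero _ hζ0), ← pow_add, ← pow_add]
    have hdj : (W : ZMod p) * d = j := by rw [hd]; field_simp
    refine hmod ?_ ?_
    · rw [← ZMod.natCast_eq_natCast_iff]
      push_cast
      rw [← hdn, ← mul_assoc, hdj]
      ring
    · have h6 (i) : W * i ≡ 0 [MOD W] := Nat.modEq_zero_iff_dvd.2 (dvd_mul_right _ _)
      refine Nat.ModEq.add ?_ ((h6 _).trans (h6 _).symm)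
      simpa using h2.mul_right j
  have hg1 : (g : ZMod p) - 1 ≠ 0 := by
    intro h
    have hg' : g = 1 := Units.ext (by simpa [sub_eq_zero] using h)
    have h2 : (2 : ZMod p) ≠ 0 := by
      intro h
      have : p ∣ 2 := (ZMod.natCast_eq_zero_iff 2 p).1 (by exact_mod_cast h)
      exact hp ((Nat.prime_dvd_prime_iff_eq hp' Nat.prime_two).1 this)
    have h3 := hg (-1)
    rw [hg', Subgroup.zpowers_one_eq_bot, Subgroup.mem_bot] at h3
    have h4 := congrArg Units.val h3
    simp only [Units.val_neg, Units.val_one] at h4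
    exact h2 (by linear_combination -h4)
  set c : ZMod p := -d / (g - 1) with hc
  have hcd : c * g + d = c := by rw [hc]; field_simp; ring
  have hshift (s : ZMod p) : ∑ x, a (x - c) * ψ (s * x) = ψ (c * s) * ∑ x, a x * ψ (s * x) := by
    rw [Finset.mul_sum]
    refine Fintype.sum_equiv (Equiv.subRight c) _ _ fun x ↦ ?_
    rw [Equiv.subRight_apply, mul_left_comm, ← ψ.map_add_eq_mul]
    congr 2
    ring
  obtain ⟨rfl, h3⟩ := eq_three_of_sum_mulShift_eq_mul (a := fun x ↦ a (x - c)) hp hw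
    (fun x ↦ ha _) (fun τ hτ ↦ by
      rw [← hac τ hτ]
      refine Fintype.sum_equiv (Equiv.subRight c) _ _ fun x ↦ ?_
      rw [Equiv.subRight_apply, sub_add_eq_add_sub]) hψ hg (ε := ζ ^ j / ψ d) (fun s hs ↦ by
      rw [hshift, hshift, hequi s hs]
      have : ψ (c * s) = ψ (c * (g * s)) * ψ (d * s) := by
        rw [← ψ.map_add_eq_mul]
        congr 1
        linear_combination -s * hcd
      rw [this]
      ring)
  exact hpw h3

end PrimeOrder

section PowersOfTwo

open ComplexConjugate

lemma four_dvd_of_re_mul_conj_eq_zero {h : ℕ} (hh : h ≠ 0) {x y : ℂ} (hx : x ^ h = 1)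
    (hy : y ^ h = 1) (hxy : (x * conj y).re = 0) : 4 ∣ h := by
  set z := x * conj y with hz
  have hzh : z ^ h = 1 := by rw [hz, mul_pow, ← map_pow, hx, hy, map_one, one_mul]
  have hz2 : z ^ 2 = -1 := by
    have h1 := Complex.sq_norm z
    rw [Complex.norm_eq_one_of_pow_eq_one hzh hh, Complex.normSq_apply, hxy] at h1
    rw [sq]
    apply Complex.ext
    · rw [Complex.mul_re, hxy, Complex.neg_re, Complex.one_re]
      linarith
    · rw [Complex.mul_im, hxy, Complex.neg_im, Complex.one_im]
      ring
  have h4 : orderOf z = 2 ^ (1 + 1) := by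
    refine orderOf_eq_prime_pow ?_ ?_
    · rw [pow_one, hz2]
      norm_num
    · rw [show 2 ^ (1 + 1) = 2 * 2 from rfl, pow_mul, hz2]
      norm_num
  rw [show 4 = 2 ^ (1 + 1) from rfl, ← h4]
  exact orderOf_dvd_of_pow_eq_one hzh

lemma re_mul_conj_comm (x y : ℂ) : (x * conj y).re = (y * conj x).re := by
  rw [Complex.mul_re, Complex.mul_re, Complex.conj_re, Complex.conj_im, Complex.conj_re,
    Complex.conj_im]
  ring

lemma four_dvd_of_autocorrelation_eq_zero_two {h : ℕ} (hh : h ≠ 0) {a : ZMod 2 → ℂ}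
    (ha : ∀ x, a x ^ h = 1) (hac : ∀ τ, τ ≠ 0 → ∑ x, a x * conj (a (x + τ)) = 0) : 4 ∣ h := by
  have h1 : a 0 * conj (a 1) + a 1 * conj (a 0) = 0 :=
    (Fin.sum_univ_two fun x : ZMod 2 ↦ a x * conj (a (x + 1))).symm.trans (hac 1 (by decide))
  refine four_dvd_of_re_mul_conj_eq_zero hh (ha 0) (ha 1) ?_
  have h2 := congrArg Complex.re h1
  rw [Complex.add_re, re_mul_conj_comm (a 1), Complex.zero_re] at h2
  linarith

lemma two_dvd_of_autocorrelation_eq_zero_four {h : ℕ} (hh : h ≠ 0) {a : ZMod 4 → ℂ}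
    (ha : ∀ x, a x ^ h = 1) (hac : ∀ τ, τ ≠ 0 → ∑ x, a x * conj (a (x + τ)) = 0) : 2 ∣ h := by
  have h1 : a 0 * conj (a 2) + a 1 * conj (a 3) + a 2 * conj (a 0) + a 3 * conj (a 1) = 0 :=
    (Fin.sum_univ_four fun x : ZMod 4 ↦ a x * conj (a (x + 2))).symm.trans (hac 2 (by decide))
  by_contra hodd
  rw [← even_iff_two_dvd, Nat.not_even_iff_odd] at hodd
  have hinv (x) : conj (a x) = (a x)⁻¹ :=
    (Complex.inv_eq_conj (Complex.norm_eq_one_of_pow_eq_one (ha x) hh)).symm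
  have h0 (x) : a x ≠ 0 := fun h ↦ by simpa [h, hh] using ha x
  simp only [hinv] at h1
  have h2 : (a 0 * a 3 + a 1 * a 2) * (a 0 * a 1 + a 2 * a 3) = 0 := by
    have := h0 0; have := h0 1; have := h0 2; have := h0 3
    field_simp at h1
    linear_combination h1
  have hneg {x y : ℂ} (hx : x ^ h = 1) (hy : y ^ h = 1) (hxy : x + y = 0) : False := by
    rw [eq_neg_of_add_eq_zero_left hxy, hodd.neg_pow, hy] at hx
    norm_num at hx
  rcases mul_eq_zero.1 h2 with h3 | h3
  · exact hneg (by rw [mul_pow, ha, ha, one_mul]) (by rw [mul_pow, ha, ha, one_mul]) h3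
  · exact hneg (by rw [mul_pow, ha, ha, one_mul]) (by rw [mul_pow, ha, ha, one_mul]) h3

lemma ZMod.sum_univ_eight (f : ZMod 8 → ℂ) :
    ∑ x, f x = f 0 + f 1 + f 2 + f 3 + f 4 + f 5 + f 6 + f 7 := Fin.sum_univ_eight f

lemma four_dvd_of_apply_one_eq_apply_five {h : ℕ} (hh : h ≠ 0) {a : ZMod 8 → ℂ}
    (ha : ∀ x, a x ^ h = 1) (hac : ∀ τ, τ ≠ 0 → ∑ x, a x * conj (a (x + τ)) = 0)
    (h15 : a 1 = a 5) (h37 : a 3 = a 7) : 4 ∣ h := by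
  have hn (x) : ‖a x‖ = 1 := Complex.norm_eq_one_of_pow_eq_one (ha x) hh
  have hself (x) : a x * conj (a x) = 1 := by
    rw [Complex.mul_conj, Complex.normSq_eq_norm_sq, hn]
    simp
  have h4 : a 0 * conj (a 4) + a 1 * conj (a 5) + a 2 * conj (a 6) + a 3 * conj (a 7) +
      a 4 * conj (a 0) + a 5 * conj (a 1) + a 6 * conj (a 2) + a 7 * conj (a 3) = 0 :=
    (ZMod.sum_univ_eight fun x ↦ a x * conj (a (x + 4))).symm.trans (hac 4 (by decide))
  have h2 : a 0 * conj (a 2) + a 1 * conj (a 3) + a 2 * conj (a 4) + a 3 * conj (a 5) +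
      a 4 * conj (a 6) + a 5 * conj (a 7) + a 6 * conj (a 0) + a 7 * conj (a 1) = 0 :=
    (ZMod.sum_univ_eight fun x ↦ a x * conj (a (x + 2))).symm.trans (hac 2 (by decide))
  have hre (x y) : -1 ≤ (a x * conj (a y)).re := by
    have := (abs_le.1 (Complex.abs_re_le_norm (a x * conj (a y)))).1
    rwa [norm_mul, RCLike.norm_conj, hn, hn, one_mul] at this
  have hopp (x y) (hxy : (a x * conj (a y)).re = -1) : a y = -a x := by
    have h1 := Complex.sq_norm (a y + a x)
    have h2 := Complex.sq_norm (a x)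
    have h3 := Complex.sq_norm (a y)
    rw [hn] at h2 h3
    rw [Complex.normSq_add, ← h2, ← h3, re_mul_conj_comm, hxy] at h1
    have h4 : ‖a y + a x‖ ^ 2 = 0 := by rw [h1]; norm_num
    exact eq_neg_of_add_eq_zero_left (norm_eq_zero.1 (pow_eq_zero_iff two_ne_zero |>.1 h4))
  have h4' := congrArg Complex.re h4
  rw [← h15, ← h37] at h4'
  simp only [Complex.add_re, hself, Complex.one_re, Complex.zero_re] at h4'
  rw [re_mul_conj_comm (a 4), re_mul_conj_comm (a 6)] at h4'
  have h04 := hopp 0 4 (by linarith [hre 0 4, hre 2 6])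
  have h26 := hopp 2 6 (by linarith [hre 0 4, hre 2 6])
  refine four_dvd_of_re_mul_conj_eq_zero hh (ha 1) (ha 3) ?_
  have h2' := congrArg Complex.re h2
  rw [← h15, ← h37, h04, h26] at h2'
  simp only [map_neg, mul_neg, neg_mul, neg_neg, Complex.add_re, Complex.neg_re,
    Complex.zero_re] at h2'
  rw [re_mul_conj_comm (a 2), re_mul_conj_comm (a 3)] at h2'
  linarith

lemma four_dvd_of_norm_two_mul_sub {h : ℕ} (hh : h ≠ 0) {x y : ℂ} (hx : x ^ h = 1)
    (hy : y ^ h = 1) (hxy : ‖2 * (x - y)‖ ^ 2 = 8) : 4 ∣ h := by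
  refine four_dvd_of_re_mul_conj_eq_zero hh hx hy ?_
  have h1 := Complex.sq_norm (x - y)
  rw [Complex.normSq_sub, ← Complex.sq_norm, ← Complex.sq_norm,
    Complex.norm_eq_one_of_pow_eq_one hx hh, Complex.norm_eq_one_of_pow_eq_one hy hh] at h1
  rw [norm_mul, mul_pow, h1, Complex.norm_ofNat] at hxy
  linarith

/-- For a circulant Butson matrix of order `8`, each of the character sums of order `8` is
supported on one class modulo `2`. -/
lemma sum_even_eq_zero_or_sum_odd_eq_zero {w : ℕ} (hw : Odd w) {a : ZMod 8 → ℂ} {ζ : ℂ}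
    (hζ : IsPrimitiveRoot ζ (8 * w)) {e : ZMod 8 → ℕ} (he : ∀ x, 2 ∣ e x)
    (hea : ∀ x, ζ ^ e x = a x) {s : ℕ} (hs : Odd s)
    (hac : ∀ τ, τ ≠ 0 → ∑ x, a x * conj (a (x + τ)) = 0) :
    ((a 0 - a 4) + (ζ ^ (w * s)) ^ 2 * (a 2 - a 6) = 0 ∧
      ‖(a 1 - a 5) + (ζ ^ (w * s)) ^ 2 * (a 3 - a 7)‖ ^ 2 = 8) ∨
    ((a 1 - a 5) + (ζ ^ (w * s)) ^ 2 * (a 3 - a 7) = 0 ∧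
      ‖(a 0 - a 4) + (ζ ^ (w * s)) ^ 2 * (a 2 - a 6)‖ ^ 2 = 8) := by
  have hM0 : 0 < 8 * w := Nat.mul_pos (by norm_num) hw.pos
  set r := ζ ^ (w * s) with hr
  have hr4 : r ^ 4 = -1 := by
    have h8 : IsPrimitiveRoot (ζ ^ w) 8 := hζ.pow hM0 (mul_comm _ _)
    have h2 : IsPrimitiveRoot ((ζ ^ w) ^ 4) 2 := h8.pow (by norm_num) (by norm_num)
    rw [hr, pow_mul, pow_right_comm, h2.eq_neg_one_of_two_right, hs.neg_one_pow]
  have hr8 : r ^ 8 = 1 := by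
    rw [show 8 = 4 * 2 from rfl, pow_mul, hr4]
    norm_num
  have hr0 : r ≠ 0 := fun h ↦ by simp [h] at hr8
  have hr1 : ‖r‖ = 1 := Complex.norm_eq_one_of_pow_eq_one hr8 (by norm_num)
  have hζ1 : ‖ζ‖ = 1 := Complex.norm_eq_one_of_pow_eq_one hζ.pow_eq_one hM0.ne'
  have hterm (x : ZMod 8) : ζ ^ (e x + w * s * x.val) = a x * r ^ x.val := by
    rw [pow_add, hea, hr, ← pow_mul]
  have hS : ‖∑ x, ζ ^ (e x + w * s * x.val)‖ ^ 2 = ((2 : ℕ) : ℝ) ^ 3 := by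
    have h1 := norm_sq_sum_mul_addChar (fun x ↦ by rw [← hea, norm_pow, hζ1, one_pow]) hac
      (AddChar.zmodChar 8 hr8)
    simp only [AddChar.zmodChar_apply, ZMod.card] at h1
    simp only [hterm]
    rw [h1]
    norm_num
  obtain ⟨y, hy⟩ := hζ.exists_sum_pow_eq_sum_filter_modEq_prime hM0
    (even_iff_two_dvd.2 (Dvd.dvd.mul_right (by norm_num) w)) Nat.prime_two
    (Dvd.dvd.mul_right (by norm_num) w) (fun _ ↦ dvd_mul_right 8 w) _ _ hS
  have hfilter (x : ZMod 8) : e x + w * s * x.val ≡ y [MOD 2] ↔ x.val % 2 = y % 2 := by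
    obtain ⟨d, hd⟩ := he x
    obtain ⟨u, hu⟩ := hw.mul hs
    rw [hd, hu, Nat.ModEq, show 2 * d + (2 * u + 1) * x.val = x.val + 2 * (d + u * x.val) by ring,
      Nat.add_mul_mod_self_left]
  have v0 : (0 : ZMod 8).val = 0 := rfl
  have v1 : (1 : ZMod 8).val = 1 := rfl
  have v2 : (2 : ZMod 8).val = 2 := rfl
  have v3 : (3 : ZMod 8).val = 3 := rfl
  have v4 : (4 : ZMod 8).val = 4 := rfl
  have v5 : (5 : ZMod 8).val = 5 := rfl
  have v6 : (6 : ZMod 8).val = 6 := rfl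
  have v7 : (7 : ZMod 8).val = 7 := rfl
  have hS' := hS
  rw [hy] at hS'
  simp only [hterm, hfilter, Finset.sum_filter, ZMod.sum_univ_eight, v0, v1, v2, v3, v4, v5, v6,
    v7] at hy hS'
  rcases Nat.mod_two_eq_zero_or_one y with h | h
  · right
    rw [h] at hy hS'
    norm_num at hy hS'
    constructor
    · refine (mul_eq_zero.1 ?_).resolve_left hr0
      linear_combination hy - (a 5 * r + a 7 * r ^ 3) * hr4
    · rw [← hS']
      congr 2
      linear_combination (-a 4 - a 6 * r ^ 2) * hr4
  · left
    rw [h] at hy hS'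
    norm_num at hy hS'
    constructor
    · linear_combination hy - (a 4 + a 6 * r ^ 2) * hr4
    · rw [← hS', ← one_mul ‖a 1 - a 5 + r ^ 2 * (a 3 - a 7)‖, ← hr1, ← norm_mul]
      congr 2
      linear_combination (-a 5 * r - a 7 * r ^ 3) * hr4

lemma not_autocorrelation_eq_zero_eight {w : ℕ} (hw : Odd w) {a : ZMod 8 → ℂ}
    (ha : ∀ x, a x ^ (2 * w) = 1) (hac : ∀ τ, τ ≠ 0 → ∑ x, a x * conj (a (x + τ)) = 0) :
    False := by
  have hw0 : 2 * w ≠ 0 := Nat.mul_ne_zero two_ne_zero hw.pos.ne'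
  have h4 : ¬ 4 ∣ 2 * w := by
    obtain ⟨u, rfl⟩ := hw
    omega
  have hM0 : 8 * w ≠ 0 := Nat.mul_ne_zero (by norm_num) hw.pos.ne'
  have hζ := Complex.isPrimitiveRoot_exp (8 * w) hM0
  set ζ := Complex.exp (2 * Real.pi * Complex.I / ((8 * w : ℕ) : ℂ))
  have he (x : ZMod 8) : ∃ e, 2 ^ (3 - 1) ∣ e ∧ ζ ^ e = a x :=
    IsPrimitiveRoot.exists_pow_eq_of_pow_eq_one (n := 3) two_pos hw.pos hζ (by norm_num)
      (by rw [pow_one, ha])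
  choose e he hea using he
  have he2 (x) : 2 ∣ e x := (by norm_num : 2 ∣ 2 ^ (3 - 1)).trans (he x)
  have hq : (ζ ^ (w * 3)) ^ 2 = -(ζ ^ (w * 1)) ^ 2 := by
    have h8 : IsPrimitiveRoot (ζ ^ w) 8 := hζ.pow hM0.bot_lt (mul_comm _ _)
    have h2 : IsPrimitiveRoot ((ζ ^ w) ^ 4) 2 := h8.pow (by norm_num) (by norm_num)
    have := h2.eq_neg_one_of_two_right
    rw [mul_one, pow_mul]
    linear_combination (ζ ^ w) ^ 2 * this
  have hI0 : (ζ ^ (w * 1)) ^ 2 ≠ 0 := pow_ne_zero _ (pow_ne_zero _ (hζ.ne_zero hM0))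
  have h1 := sum_even_eq_zero_or_sum_odd_eq_zero hw hζ he2 hea odd_one hac
  have h3 := sum_even_eq_zero_or_sum_odd_eq_zero hw hζ he2 hea (by decide : Odd 3) hac
  rw [hq] at h3
  set I' := (ζ ^ (w * 1)) ^ 2
  have hboth {x y : ℂ} (hx : x + I' * y = 0) (hy : x + -I' * y = 0) : x = 0 ∧ y = 0 := by
    have hx0 : x = 0 := by linear_combination (hx + hy) / 2
    refine ⟨hx0, ?_⟩
    rw [hx0, zero_add] at hx
    exact (mul_eq_zero.1 hx).resolve_left hI0
  have hmix {y : ℂ} {i j : ZMod 8} (hy : (a i - a j) + -I' * y = 0)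
      (h : ‖(a i - a j) + I' * y‖ ^ 2 = 8) : False := by
    refine h4 (four_dvd_of_norm_two_mul_sub hw0 (ha i) (ha j) ?_)
    rw [← h]
    congr 2
    linear_combination hy
  rcases h1 with ⟨h1, h1n⟩ | ⟨h1, h1n⟩ <;> rcases h3 with ⟨h3, h3n⟩ | ⟨h3, h3n⟩
  · obtain ⟨h04, h26⟩ := hboth h1 h3
    refine h4 (four_dvd_of_apply_one_eq_apply_five (a := fun x ↦ a (x + 1)) hw0 (fun x ↦ ha _)
      (fun τ hτ ↦ ?_) (sub_eq_zero.1 h26) (sub_eq_zero.1 h04).symm)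
    rw [← hac τ hτ]
    refine Fintype.sum_equiv (Equiv.addRight 1) _ _ fun x ↦ ?_
    rw [Equiv.coe_addRight, add_right_comm]
  · exact hmix h3 h1n
  · exact hmix h3 h1n
  · obtain ⟨h15, h37⟩ := hboth h1 h3
    exact h4 (four_dvd_of_apply_one_eq_apply_five hw0 ha hac (sub_eq_zero.1 h15)
      (sub_eq_zero.1 h37))

end PowersOfTwo

open ComplexConjugate in
lemma le_two_mul_of_autocorrelation_eq_zero {p n k m w : ℕ} (hp : p.Prime) [NeZero (p ^ n)]
    {a : ZMod (p ^ n) → ℂ} (hw : ¬ p ∣ w) (ha : ∀ x, a x ^ (p ^ k * w) = 1)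
    (hac : ∀ τ, τ ≠ 0 → ∑ x, a x * conj (a (x + τ)) = 0) (hkm : k ≤ m) (hmn : m ≤ n) (hm : 1 ≤ m)
    (hm2 : p = 2 → 2 ≤ m) : n ≤ 2 * m ∧ (k < m → n ≠ 2 * m) := by
  have hw0 : 0 < w := Nat.pos_of_ne_zero fun h ↦ hw (h ▸ dvd_zero p)
  have hpw := hp.coprime_iff_not_dvd.2 hw
  obtain ⟨W, hwW, hpW, hW0, hM⟩ : ∃ W, w ∣ W ∧ p.Coprime W ∧ 0 < W ∧ Even (p ^ n * W) := by
    rcases hp.eq_two_or_odd' with rfl | hodd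
    · exact ⟨w, dvd_rfl, hpw, hw0, (even_two.pow_of_ne_zero (by omega)).mul_right w⟩
    · exact ⟨2 * w, dvd_mul_left w 2, hodd.coprime_two_right.mul_right hpw, by omega,
        (even_two_mul w).mul_left _⟩
  have hM0 : p ^ n * W ≠ 0 := Nat.mul_ne_zero (NeZero.ne _) hW0.ne'
  have hζ := Complex.isPrimitiveRoot_exp (p ^ n * W) hM0
  set ζ := Complex.exp (2 * Real.pi * Complex.I / ((p ^ n * W : ℕ) : ℂ))
  have hζ1 : ‖ζ‖ = 1 := Complex.norm_eq_one_of_pow_eq_one hζ.pow_eq_one hM0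
  have he (x : ZMod (p ^ n)) : ∃ e, p ^ (n - k) ∣ e ∧ ζ ^ e = a x := by
    refine hζ.exists_pow_eq_of_pow_eq_one hp.pos hW0 (by omega) ?_
    obtain ⟨d, rfl⟩ := hwW
    rw [← mul_assoc, pow_mul, ha, one_pow]
  choose e he hea using he
  refine le_two_mul_of_norm_sq_sum_eq hp hW0 hpW hM hζ hkm hmn hm hm2 he ?_
  have hψ : (ζ ^ W) ^ p ^ n = 1 := by rw [← pow_mul, mul_comm, hζ.pow_eq_one]
  have h1 := norm_sq_sum_mul_addChar (fun x ↦ by rw [← hea, norm_pow, hζ1, one_pow]) hac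
    (AddChar.zmodChar (p ^ n) hψ)
  simp only [AddChar.zmodChar_apply, ZMod.card, ← hea, ← pow_mul, ← pow_add] at h1
  rw [h1]
  push_cast
  rfl

lemma valuation_of_exists_isBHMatrix {p n v h : ℕ} (hp : p.Prime) (hv : v = p ^ n) (hh : h ≠ 0)
    [NeZero v] (hH : ∃ H : Matrix (ZMod v) (ZMod v) ℂ, IsBHMatrix H h) :
    (n + 1) / 2 ≤ padicValNat p h ∧ ¬(v = 2 ∧ padicValNat 2 h = 1) := by
  obtain ⟨a, ha, hac⟩ := (exists_isBHMatrix_iff hh).1 hH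
  have hp' := Fact.mk hp
  have htwo (hv2 : v = 2) : 2 ≤ padicValNat 2 h := by
    subst hv2
    exact (padicValNat_dvd_iff_le hh).1 (four_dvd_of_autocorrelation_eq_zero_two hh ha hac)
  refine ⟨?_, fun h2 ↦ by have := htwo h2.1; omega⟩
  by_contra! hlt
  set k := padicValNat p h with hk
  obtain ⟨w, hw⟩ := (padicValNat_dvd_iff_le (p := p) hh).2 hk.ge
  have hpw : ¬ p ∣ w := by
    rintro ⟨d, rfl⟩
    have : p ^ (k + 1) ∣ h := ⟨d, by rw [hw]; ring⟩
    exact absurd ((padicValNat_dvd_iff_le hh).1 this) (by omega)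
  have hndvd (hk0 : k = 0) : ¬ p ∣ h := fun h1 ↦ by
    have := (padicValNat_dvd_iff_le hh).1 ((pow_one p).symm ▸ h1)
    omega
  subst hv
  have hbound {m : ℕ} (hkm : k ≤ m) (hmn : m ≤ n) (hm : 1 ≤ m) (hm2 : p = 2 → 2 ≤ m) :=
    le_two_mul_of_autocorrelation_eq_zero hp hpw (fun x ↦ hw ▸ ha x) hac hkm hmn hm hm2
  by_cases hp2 : p = 2
  · subst hp2
    rcases le_or_gt 2 k with hk2 | hk2
    · have := hbound le_rfl (by omega) (by omega) (fun _ ↦ hk2)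
      omega
    · obtain rfl | hn : n = 1 ∨ 2 ≤ n := by omega
      · have := htwo (by norm_num)
        omega
      · have := hbound hk2.le hn one_le_two (fun _ ↦ le_rfl)
        obtain rfl | rfl : n = 2 ∨ n = 3 := by omega
        · exact hndvd (by omega) (two_dvd_of_autocorrelation_eq_zero_four hh ha hac)
        · refine not_autocorrelation_eq_zero_eight (w := w) ?_ (a := a) (fun x ↦ ?_) hac
          · rwa [← Nat.not_even_iff_odd, even_iff_two_dvd]
          · have h1 : h ∣ 2 * w := by
              rw [hw]
              exact Nat.mul_dvd_mul_right (pow_dvd_pow 2 (by omega : k ≤ 1)) w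
            obtain ⟨d, hd⟩ := h1
            rw [hd, pow_mul, ha, one_pow]
  · rcases Nat.eq_zero_or_pos k with hk0 | hk0
    · have := hbound (m := 1) (by omega) (by omega) le_rfl (fun h ↦ absurd h hp2)
      obtain rfl : n = 1 := by omega
      refine hndvd hk0 ?_
      have key : ∀ v : ℕ, [NeZero v] → v = p → ∀ a : ZMod v → ℂ, (∀ x, a x ^ h = 1) →
          (∀ τ, τ ≠ 0 → ∑ x, a x * (starRingEnd ℂ) (a (x + τ)) = 0) → p ∣ h := by
        rintro v _ rfl a ha hac
        exact dvd_of_autocorrelation_eq_zero hp2 hh ha hac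
      exact key _ (pow_one p) a ha hac
    · have := hbound le_rfl (by omega) hk0 (fun h ↦ absurd h hp2)
      omega

/-- Theorem 3.6 of the paper. Let `v = p^n` be a power of a prime `p` and
let `h` be a positive integer.  A (circulant) `BH(ℤ_v, h)` matrix exists if and only if
`ν_p(h) ≥ ⌈ν_p(v)/2⌉` and `(v, ν_2(h)) ≠ (2, 1)`. -/
theorem statement8
    (p n v h : ℕ) (hp : p.Prime) (hv : v = p ^ n) (hh : 0 < h) :
    (haveI : NeZero v := ⟨hv ▸ pow_ne_zero n hp.ne_zero⟩
      ∃ H : Matrix (ZMod v) (ZMod v) ℂ, IsBHMatrix H h) ↔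
    ((padicValNat p v + 1) / 2 ≤ padicValNat p h ∧ ¬(v = 2 ∧ padicValNat 2 h = 1)) := by
  have : Fact p.Prime := ⟨hp⟩
  have : NeZero v := ⟨hv ▸ pow_ne_zero n hp.ne_zero⟩
  have hval : padicValNat p v = n := by rw [hv, padicValNat.prime_pow]
  rw [hval]
  refine ⟨valuation_of_exists_isBHMatrix hp hv hh.ne', fun hn ↦ ?_⟩
  subst hv
  exact exists_isBHMatrix_of_valuation hp hh.ne' hn.1 hn.2
end

section
/- Let a ∈ {3, 4} and let h be a positive integer with ν_2(h) = 1 (i.e., h ≡ 2 (mod 4)). Then no BH(ℤ_{2^a}, h) matrix exists. -/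
open scoped BigOperators

/-- An additive character sum that vanishes at every frequency has zero coefficients. -/
theorem AddChar.IsPrimitive.eq_zero_of_forall_sum_eq_zero {R K : Type*} [CommRing R] [Fintype R]
    [Field K] [CharZero K] {ψ : AddChar R K} (hψ : ψ.IsPrimitive) {d : R → K}
    (h : ∀ t, ∑ r, d r * ψ (t * r) = 0) : d = 0 := by
  classical
  funext s
  have key : ∑ t, ψ (-(t * s)) * ∑ r, d r * ψ (t * r) = Fintype.card R * d s := by
    calc ∑ t, ψ (-(t * s)) * ∑ r, d r * ψ (t * r)
        = ∑ r, d r * ∑ t, ψ (t * (r - s)) := by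
          simp_rw [Finset.mul_sum]
          rw [Finset.sum_comm]
          refine Finset.sum_congr rfl fun r _ => Finset.sum_congr rfl fun t _ => ?_
          rw [show t * (r - s) = -(t * s) + t * r by ring, AddChar.map_add_eq_mul]
          ring
      _ = Fintype.card R * d s := by
          simp_rw [AddChar.sum_mulShift _ hψ, sub_eq_zero]
          simp [mul_comm]
  simp only [h, mul_zero, Finset.sum_const_zero] at key
  have : (Fintype.card R : K) ≠ 0 := Nat.cast_ne_zero.mpr Fintype.card_ne_zero
  simpa [this] using key.symm

/-- A ring automorphism acting trivially modulo every prime containing `x` fixes the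
ideal generated by `x`. -/
theorem RingEquiv.associated_apply_of_forall_prime {R : Type*} [CommRing R] [IsDedekindDomain R]
    (σ : R ≃+* R) {x : R} (hx : x ≠ 0)
    (h : ∀ P : Ideal R, P.IsPrime → x ∈ P → ∀ y, σ y - y ∈ P) : Associated (σ x) x := by
  have main : ∀ I : Ideal R, I ≠ 0 → (∀ P : Ideal R, P.IsPrime → I ≤ P → ∀ y, σ y - y ∈ P) →
      I.map σ = I := by
    intro I
    induction I using UniqueFactorizationMonoid.induction_on_prime with
    | h₁ => intro h0; exact absurd rfl h0
    | h₂ I hI =>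
      intro _ _
      rw [Ideal.isUnit_iff.mp hI, Ideal.map_top]
    | h₃ I P hI hP ih =>
      intro _ H
      have hPI : P.map σ = P := by
        have HP := H P (Ideal.isPrime_of_prime hP) Ideal.mul_le_left
        refine le_antisymm (Ideal.map_le_iff_le_comap.mpr fun y hy => ?_) fun y hy => ?_
        · have := P.add_mem (HP y) hy
          simpa using this
        · have h1 : σ.symm y ∈ P := by
            have := P.sub_mem hy (HP (σ.symm y))
            simpa using this
          simpa using Ideal.mem_map_of_mem σ h1
      have hII : I.map σ = I := ih hI fun Q hQ hIQ => H Q hQ (Ideal.mul_le_right.trans hIQ)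
      rw [Ideal.map_mul, hPI, hII]
  have := main (Ideal.span {x}) (by simpa using hx)
    fun P hP hxP => h P hP ((Ideal.span_singleton_le_iff_mem _).mp hxP)
  rw [Ideal.map_span, Set.image_singleton] at this
  exact Ideal.span_singleton_eq_span_singleton.mp this

namespace IsCyclotomicExtension.Rat

open NumberField

variable {K : Type*} [Field K] [NumberField K] {N : ℕ} [NeZero N] [IsCyclotomicExtension {N} ℚ K]

/-- An automorphism multiplying `ζ` by a root of unity of `p`-power order is in the inertia group
of every prime above `p`. -/
theorem apply_sub_mem_of_pow_eq_one {ζ : K} (hζ : IsPrimitiveRoot ζ N) {p a : ℕ} [Fact p.Prime]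
    {σ : K ≃ₐ[ℚ] K} {w : 𝓞 K} (hw : w ^ p ^ a = 1) (hσ : σ ζ = ζ * w)
    {P : Ideal (𝓞 K)} [P.IsPrime] (hp : (p : 𝓞 K) ∈ P) (y : 𝓞 K) :
    RingOfIntegers.mapRingEquiv σ.toRingEquiv y - y ∈ P := by
  have hchar : CharP (𝓞 K ⧸ P) p := by
    refine (CharP.charP_iff_prime_eq_zero Fact.out).mpr ?_
    rw [← map_natCast (Ideal.Quotient.mk P), Ideal.Quotient.eq_zero_iff_mem]
    exact hp
  have hw1 : Ideal.Quotient.mk P w = 1 := by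
    rw [← sub_eq_zero]
    refine eq_zero_of_pow_eq_zero (n := p ^ a) ?_
    rw [sub_pow_char_pow, ← map_pow, hw]
    simp
  let f : 𝓞 K →ₐ[ℤ] 𝓞 K ⧸ P := ((Ideal.Quotient.mk P).comp
    (RingOfIntegers.mapRingEquiv σ.toRingEquiv : 𝓞 K →+* 𝓞 K)).toIntAlgHom
  let g : 𝓞 K →ₐ[ℤ] 𝓞 K ⧸ P := (Ideal.Quotient.mk P).toIntAlgHom
  have hfg : f = g := by
    refine hζ.integralPowerBasis.algHom_ext ?_
    rw [hζ.integralPowerBasis_gen]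
    have : RingOfIntegers.mapRingEquiv σ.toRingEquiv hζ.toInteger = hζ.toInteger * w := by
      ext
      exact hσ
    change Ideal.Quotient.mk P (RingOfIntegers.mapRingEquiv σ.toRingEquiv hζ.toInteger) =
      Ideal.Quotient.mk P hζ.toInteger
    rw [this, map_mul, hw1, mul_one]
  exact Ideal.Quotient.eq.mp (DFunLike.congr_fun hfg y)

/-- If `x` has absolute value `p ^ (e / 2)` in every complex embedding, then an automorphism in the
inertia group at `p` multiplies `x` by a root of unity. -/
theorem exists_pow_eq_one_apply_eq_mul (hN : Even N) {ζ : K} (hζ : IsPrimitiveRoot ζ N) {p a e : ℕ}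
    [hp : Fact p.Prime] {σ : K ≃ₐ[ℚ] K} {w : 𝓞 K} (hw : w ^ p ^ a = 1) (hσ : σ ζ = ζ * w)
    {x : 𝓞 K} (hx : ∀ φ : K →+* ℂ, ‖φ x‖ ^ 2 = p ^ e) (hxp : x ∣ (p : 𝓞 K) ^ e) :
    ∃ u : K, u ^ N = 1 ∧ σ x = u * x := by
  have hp0 : (p : ℝ) ^ e ≠ 0 := pow_ne_zero _ (Nat.cast_ne_zero.mpr hp.out.ne_zero)
  have hx0 : x ≠ 0 := by
    rintro rfl
    obtain ⟨φ⟩ : Nonempty (K →+* ℂ) := inferInstance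
    exact hp0 (by simpa using (hx φ).symm)
  obtain ⟨v, hv⟩ := (RingEquiv.associated_apply_of_forall_prime
    (RingOfIntegers.mapRingEquiv σ.toRingEquiv) hx0 fun P hP hxP =>
      apply_sub_mem_of_pow_eq_one hζ hw hσ
        (hP.mem_of_pow_mem e (P.mem_of_dvd hxp hxP))).symm
  have hvx : σ x = x * (v : 𝓞 K) := congrArg (algebraMap (𝓞 K) K) hv.symm
  have htors : v ∈ Units.torsion K := by
    rw [Units.mem_torsion]
    intro φ
    rw [← InfinitePlace.norm_embedding_eq]
    have h1 := hx (φ.embedding.comp σ.toRingEquiv.toRingHom)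
    have h2 : ‖φ.embedding (σ x)‖ ^ 2 = p ^ e := h1
    rw [hvx, map_mul, norm_mul, mul_pow, hx φ.embedding] at h2
    exact (pow_eq_one_iff_of_nonneg (norm_nonneg _) two_ne_zero).mp
      (mul_left_cancel₀ hp0 (by rw [h2, mul_one]))
  rw [← Units.rootsOfUnity_eq_torsion, torsionOrder_eq (n := N), if_pos hN,
    mem_rootsOfUnity] at htors
  refine ⟨(v : 𝓞 K), ?_, by rw [hvx, mul_comm]⟩
  have := congrArg (fun z : (𝓞 K)ˣ => ((z : 𝓞 K) : K)) htors
  simpa using this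

/-- Galois automorphisms acting on `r`-th roots of unity as `t` and fixing `m`-th roots of unity. -/
theorem exists_algEquiv {n m : ℕ} [NeZero n] (hnm : n.Coprime m) [IsCyclotomicExtension {n * m} ℚ K]
    [NeZero (n * m)] {ζ : K} (hζ : IsPrimitiveRoot ζ (n * m)) {ω : K} (hω : IsPrimitiveRoot ω n)
    (t : (ZMod n)ˣ) :
    ∃ σ : K ≃ₐ[ℚ] K, (∀ r, σ (AddChar.zmodChar n hω.pow_eq_one r) =
        AddChar.zmodChar n hω.pow_eq_one (t * r)) ∧
      (∀ α : K, α ^ m = 1 → σ α = α) ∧ ∃ w : 𝓞 K, w ^ n = 1 ∧ σ ζ = ζ * w := by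
  have hm : m ≠ 0 := right_ne_zero_of_mul (NeZero.ne (n * m))
  have : NeZero m := ⟨hm⟩
  obtain ⟨k, hkn, hkm⟩ := Nat.chineseRemainder hnm (t : ZMod n).val 1
  have hk : k.Coprime (n * m) := by
    refine Nat.Coprime.mul_right ?_ ?_
    · rw [Nat.Coprime, hkn.gcd_eq]
      exact ZMod.val_coe_unit_coprime t
    · rw [Nat.Coprime, hkm.gcd_eq]
      simp
  have hirr := Polynomial.cyclotomic.irreducible_rat (NeZero.pos (n * m))
  have hζk := hζ.pow_of_coprime k hk
  obtain ⟨σ, hσ⟩ : ∃ σ : K ≃ₐ[ℚ] K, σ ζ = ζ ^ k := by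
    have hmin : minpoly ℚ (hζ.powerBasis ℚ).gen = minpoly ℚ (hζk.powerBasis ℚ).gen := by
      rw [hζ.powerBasis_gen ℚ, hζk.powerBasis_gen ℚ,
        ← hζ.minpoly_eq_cyclotomic_of_irreducible hirr,
        ← hζk.minpoly_eq_cyclotomic_of_irreducible hirr]
    refine ⟨(hζ.powerBasis ℚ).equivOfMinpoly (hζk.powerBasis ℚ) hmin, ?_⟩
    have := (hζ.powerBasis ℚ).equivOfMinpoly_gen (hζk.powerBasis ℚ) hmin
    rwa [hζ.powerBasis_gen ℚ, hζk.powerBasis_gen ℚ] at this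
  have hpow : ∀ z : K, z ^ (n * m) = 1 → σ z = z ^ k := by
    intro z hz
    obtain ⟨i, -, rfl⟩ := hζ.eq_pow_of_pow_eq_one hz
    rw [map_pow, hσ, pow_right_comm]
  refine ⟨σ, fun r => ?_, fun α hα => ?_, ?_⟩
  · rw [hpow, ← AddChar.map_nsmul_eq_pow]
    · congr 1
      rw [nsmul_eq_mul, (ZMod.natCast_eq_natCast_iff _ _ _).mpr hkn, ZMod.natCast_zmod_val]
    · rw [← AddChar.map_nsmul_eq_pow]
      simp
  · rw [hpow α (by rw [mul_comm, pow_mul, hα, one_pow])]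
    have := pow_eq_pow_mod k hα
    rw [this, hkm, ← pow_eq_pow_mod 1 hα, pow_one]
  · have hz0 : ζ ≠ 0 := hζ.ne_zero (NeZero.ne _)
    have hw : (σ ζ / ζ) ^ n = 1 := by
      have h1 : σ (ζ ^ n) = ζ ^ n := by
        rw [hpow _ (by rw [pow_right_comm, hζ.pow_eq_one, one_pow]), ← pow_mul]
        have h2 : (ζ ^ n) ^ m = 1 := by rw [← pow_mul, hζ.pow_eq_one]
        have := pow_eq_pow_mod k h2
        rw [pow_mul, this, hkm, ← pow_eq_pow_mod 1 h2, pow_one]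
      rw [div_pow, ← map_pow, h1, div_self (pow_ne_zero _ hz0)]
    have hint : IsIntegral ℤ (σ ζ / ζ) := by
      refine IsIntegral.of_pow (NeZero.pos n) ?_
      rw [hw]
      exact isIntegral_one
    refine ⟨⟨_, hint⟩, ?_, ?_⟩
    · exact RingOfIntegers.ext hw
    · exact (mul_div_cancel₀ _ hz0).symm

end IsCyclotomicExtension.Rat

/-- In `ℤ / 2^a`, multiplying the element of order two by `s` gives zero unless `s` is a unit. -/
theorem ZMod.mul_two_pow_eq_zero_or_isUnit {a : ℕ} (ha : a ≠ 0) (s : ZMod (2 ^ a)) :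
    s * 2 ^ (a - 1) = 0 ∨ IsUnit s ∧ s * 2 ^ (a - 1) = 2 ^ (a - 1) := by
  have h2 : (2 : ZMod (2 ^ a)) * 2 ^ (a - 1) = 0 := by
    rw [← pow_succ', Nat.sub_one_add_one ha]
    exact_mod_cast ZMod.natCast_self (2 ^ a)
  rw [← ZMod.natCast_zmod_val s]
  rcases Nat.even_or_odd' s.val with ⟨k, hk | hk⟩
  · left
    rw [hk]
    push_cast
    rw [mul_comm 2 (k : ZMod (2 ^ a)), mul_assoc, h2, mul_zero]
  · right
    refine ⟨(ZMod.isUnit_iff_coprime _ _).mpr (Nat.Coprime.pow_right _ ?_), ?_⟩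
    · rw [Nat.coprime_two_right, hk]
      exact odd_two_mul_add_one k
    · rw [hk]
      push_cast
      linear_combination (k : ZMod (2 ^ a)) * h2

/-- A product decomposition of `n * m`-th roots of unity for coprime `n` and `m`. -/
theorem exists_eq_mul_of_pow_mul_eq_one {M : Type*} [Monoid M] {n m : ℕ} (h : n.Coprime m) {u : M}
    (hu : u ^ (n * m) = 1) : ∃ x y : M, x ^ m = 1 ∧ y ^ n = 1 ∧ u = x * y := by
  obtain ⟨p, hpn, hpm⟩ := Nat.chineseRemainder h 0 1
  obtain ⟨q, hqn, hqm⟩ := Nat.chineseRemainder h 1 0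
  refine ⟨u ^ p, u ^ q, ?_, ?_, ?_⟩
  · obtain ⟨c, rfl⟩ := (Nat.modEq_zero_iff_dvd.mp hpn)
    rw [← pow_mul, mul_right_comm, pow_mul, hu, one_pow]
  · obtain ⟨c, rfl⟩ := (Nat.modEq_zero_iff_dvd.mp hqm)
    rw [← pow_mul, mul_right_comm, mul_comm m n, pow_mul, hu, one_pow]
  · have : p + q ≡ 1 [MOD n * m] := (Nat.modEq_and_modEq_iff_modEq_mul h).mp
      ⟨by simpa using hpn.add hqn, by simpa using hpm.add hqm⟩
    rw [← pow_add, pow_eq_pow_mod _ hu, this, ← pow_eq_pow_mod _ hu, pow_one]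

/-- The product of a character sum and its conjugate, for a perfect sequence. -/
theorem AddChar.sum_mul_sum_neg_of_perfect {G K : Type*} [AddCommGroup G] [Fintype G]
    [Field K] (ψ : AddChar G K) {g : G → K} (h0 : ∀ i, g i ≠ 0)
    (corr : ∀ k, k ≠ 0 → ∑ i, g (i + k) * (g i)⁻¹ = 0) :
    (∑ i, g i * ψ i) * ∑ i, (g i)⁻¹ * ψ (-i) = Fintype.card G := by
  classical
  calc (∑ i, g i * ψ i) * ∑ i, (g i)⁻¹ * ψ (-i)
      = ∑ i, ∑ k, (g (i + k) * (g i)⁻¹) * ψ k := by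
        rw [Finset.mul_sum]
        refine Finset.sum_congr rfl fun i _ => ?_
        rw [← Equiv.sum_comp (Equiv.addLeft i), Finset.sum_mul]
        refine Finset.sum_congr rfl fun k _ => ?_
        rw [Equiv.coe_addLeft, AddChar.map_add_eq_mul]
        have : ψ i * ψ (-i) = 1 := by rw [← AddChar.map_add_eq_mul]; simp
        linear_combination g (i + k) * (g i)⁻¹ * ψ k * this
    _ = ∑ k, (∑ i, g (i + k) * (g i)⁻¹) * ψ k := by
        rw [Finset.sum_comm]
        simp_rw [Finset.sum_mul]
    _ = Fintype.card G := by
        rw [Finset.sum_eq_single 0 (fun k _ hk => by rw [corr k hk, zero_mul]) (by simp)]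
        simp [h0]

/-- Twisting a perfect sequence over `ℤ / 2^a` by a unit changes its odd part only by a translation
and a scalar of odd order. -/
theorem IsCyclotomicExtension.Rat.exists_twist {a m : ℕ} (ha : a ≠ 0) (hm : Odd m)
    {K : Type*} [Field K] [NumberField K] [NeZero (2 ^ a * m)]
    [IsCyclotomicExtension {2 ^ a * m} ℚ K] {g : ZMod (2 ^ a) → K}
    (hgm : ∀ i, g i ^ (2 * m) = 1) (hgcorr : ∀ k, k ≠ 0 → ∑ i, g (i + k) * (g i)⁻¹ = 0)
    (t : (ZMod (2 ^ a))ˣ) :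
    ∃ (α : K) (j : ZMod (2 ^ a)), α ^ m = 1 ∧ ∀ r, g r - g (r + 2 ^ (a - 1)) =
      α * (g (t * r - j) - g (t * r - j + 2 ^ (a - 1))) := by
  have hm0 : m ≠ 0 := hm.pos.ne'
  have hnm : (2 ^ a).Coprime m := Nat.Coprime.pow_left _ (Nat.coprime_two_left.mpr hm)
  have hζ := IsCyclotomicExtension.zeta_spec (2 ^ a * m) ℚ K
  set ζ : K := IsCyclotomicExtension.zeta (2 ^ a * m) ℚ K
  have hg0 : ∀ i, g i ≠ 0 := fun i h => by
    have := hgm i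
    rw [h, zero_pow (mul_ne_zero two_ne_zero hm0)] at this
    exact zero_ne_one this
  have hω : IsPrimitiveRoot (ζ ^ m) (2 ^ a) := hζ.pow (NeZero.pos _) (mul_comm _ _)
  set ψ := AddChar.zmodChar (2 ^ a) hω.pow_eq_one with hψ
  have hψprim : ψ.IsPrimitive := AddChar.zmodChar_primitive_of_primitive_root _ hω
  have hψpow : ∀ i, ψ i ^ 2 ^ a = 1 := fun i => by
    rw [← AddChar.map_nsmul_eq_pow]
    simp
  have hXX := AddChar.sum_mul_sum_neg_of_perfect ψ hg0 hgcorr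
  have hgint : ∀ i, IsIntegral ℤ (g i) := fun i =>
    IsIntegral.of_pow (n := 2 * m) (by positivity) (by rw [hgm]; exact isIntegral_one)
  have hψint : ∀ i, IsIntegral ℤ (ψ i) := fun i =>
    IsIntegral.of_pow (n := 2 ^ a) (by positivity) (by rw [hψpow]; exact isIntegral_one)
  have hginv : ∀ i, IsIntegral ℤ (g i)⁻¹ := fun i =>
    IsIntegral.of_pow (n := 2 * m) (by positivity) (by
      rw [inv_pow, hgm, inv_one]; exact isIntegral_one)
  let x : NumberField.RingOfIntegers K :=
    ⟨∑ i, g i * ψ i, IsIntegral.sum _ fun i _ => (hgint i).mul (hψint i)⟩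
  let y : NumberField.RingOfIntegers K :=
    ⟨∑ i, (g i)⁻¹ * ψ (-i), IsIntegral.sum _ fun i _ => (hginv i).mul (hψint (-i))⟩
  have hxy : x * y = (2 : ℕ) ^ a := by
    apply NumberField.RingOfIntegers.ext
    rw [← Nat.cast_pow]
    refine Eq.trans ?_ (map_natCast (algebraMap (NumberField.RingOfIntegers K) K) _).symm
    rw [ZMod.card] at hXX
    exact hXX
  have hconj : ∀ θ : K →+* ℂ, θ (∑ i, (g i)⁻¹ * ψ (-i)) =
      starRingEnd ℂ (θ (∑ i, g i * ψ i)) := by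
    intro θ
    simp only [map_sum, map_mul, map_inv₀, AddChar.map_neg_eq_inv]
    refine Finset.sum_congr rfl fun i _ => ?_
    have h1 : ‖θ (g i)‖ = 1 :=
      Complex.norm_eq_one_of_pow_eq_one (n := 2 * m) (by rw [← map_pow, hgm, map_one])
        (by positivity)
    have h2 : ‖θ (ψ i)‖ = 1 :=
      Complex.norm_eq_one_of_pow_eq_one (n := 2 ^ a) (by rw [← map_pow, hψpow, map_one])
        (by positivity)
    rw [Complex.inv_eq_conj h1, Complex.inv_eq_conj h2]
  have hnorm : ∀ θ : K →+* ℂ, ‖θ x‖ ^ 2 = (2 : ℕ) ^ a := by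
    intro θ
    have h1 : θ (∑ i, g i * ψ i) * θ (∑ i, (g i)⁻¹ * ψ (-i)) = 2 ^ a := by
      rw [← map_mul, hXX, ZMod.card, map_natCast, Nat.cast_pow, Nat.cast_ofNat]
    rw [hconj, Complex.mul_conj, Complex.normSq_eq_norm_sq] at h1
    exact_mod_cast h1
  obtain ⟨σ, hσψ, hσα, w, hw, hσζ⟩ := IsCyclotomicExtension.Rat.exists_algEquiv hnm hζ hω t
  obtain ⟨u, hu, hσu⟩ := IsCyclotomicExtension.Rat.exists_pow_eq_one_apply_eq_mul
    ((Nat.even_pow.mpr ⟨even_two, ha⟩).mul_right m) hζ hw hσζ hnorm ⟨y, hxy.symm⟩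
  obtain ⟨α, β, hα, hβ, rfl⟩ := exists_eq_mul_of_pow_mul_eq_one hnm hu
  obtain ⟨j, hj⟩ : ∃ j, β = ψ j := by
    obtain ⟨i, -, hi⟩ := hω.eq_pow_of_pow_eq_one hβ
    exact ⟨i, by rw [hψ, AddChar.zmodChar_apply', hi]⟩
  subst hj
  have hfix : ∀ τ : K ≃ₐ[ℚ] K, (∀ z : K, z ^ m = 1 → τ z = z) → ∀ i, τ (g i) = g i := by
    intro τ hτ i
    have : g i ^ m * g i ^ m = 1 := by rw [← pow_add, ← two_mul, hgm]
    rcases mul_self_eq_one_iff.mp this with h | h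
    · exact hτ _ h
    · have := hτ (-g i) (by rw [hm.neg_pow, h, neg_neg])
      simpa using this
  have hσx : ∑ i, g i * ψ (t * i) = α * ψ j * ∑ i, g i * ψ i := by
    refine Eq.trans ?_ hσu
    change _ = σ (∑ i, g i * ψ i)
    rw [map_sum]
    exact Finset.sum_congr rfl fun i _ => by rw [map_mul σ, hfix σ hσα, hσψ]
  have htwist : ∀ s : (ZMod (2 ^ a))ˣ, ∑ i, g i * ψ (s * (t * i)) =
      α * ψ (s * j) * ∑ i, g i * ψ (s * i) := by
    intro s
    obtain ⟨τ, hτψ, hτα, -⟩ := IsCyclotomicExtension.Rat.exists_algEquiv hnm hζ hω s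
    have := congrArg τ hσx
    simp only [map_sum, map_mul, hfix τ hτα, hτα α hα] at this
    simpa only [hψ, hτψ] using this
  have hhalf : ∀ s, ∑ i, (g i - g (i + 2 ^ (a - 1))) * ψ (s * i) =
      (1 - ψ (-(s * 2 ^ (a - 1)))) * ∑ i, g i * ψ (s * i) := by
    intro s
    simp_rw [sub_mul, Finset.sum_sub_distrib, one_mul]
    congr 1
    rw [← Equiv.sum_comp (Equiv.addRight (2 ^ (a - 1))) fun i => g i * ψ (s * i), Finset.mul_sum]
    refine Finset.sum_congr rfl fun i _ => ?_
    rw [Equiv.coe_addRight, mul_left_comm, ← AddChar.map_add_eq_mul]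
    congr 2
    ring
  have hodd : ∀ s, ∑ i, (g i - g (i + 2 ^ (a - 1))) * ψ (s * (t * i)) =
      α * ψ (s * j) * ∑ i, (g i - g (i + 2 ^ (a - 1))) * ψ (s * i) := by
    intro s
    have h1 := hhalf s
    have h2 := hhalf (s * t)
    simp_rw [mul_assoc s] at h2
    rw [h1, h2]
    have ht : (t : ZMod (2 ^ a)) * 2 ^ (a - 1) = 2 ^ (a - 1) := by
      rcases ZMod.mul_two_pow_eq_zero_or_isUnit ha (t : ZMod (2 ^ a)) with h | h
      · rw [Units.mul_right_eq_zero] at h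
        simp [h]
      · exact h.2
    rw [ht]
    rcases ZMod.mul_two_pow_eq_zero_or_isUnit ha s with h | ⟨⟨s, rfl⟩, -⟩
    · simp [h]
    · rw [htwist s]
      ring
  let c : ZMod (2 ^ a) → K := fun i => g i - g (i + 2 ^ (a - 1))
  have hzero : (fun r => c (↑t⁻¹ * r) - α * c (r - j)) = 0 := by
    refine hψprim.eq_zero_of_forall_sum_eq_zero fun s => ?_
    simp_rw [sub_mul, Finset.sum_sub_distrib]
    rw [sub_eq_zero, ← Equiv.sum_comp (Units.mulLeft t),
      ← Equiv.sum_comp (Equiv.addRight j) fun r => α * c (r - j) * ψ (s * r)]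
    simp only [Units.mulLeft_apply, Units.inv_mul_cancel_left, Equiv.coe_addRight,
      add_sub_cancel_right]
    refine (hodd s).trans ?_
    rw [Finset.mul_sum]
    refine Finset.sum_congr rfl fun i _ => ?_
    rw [mul_add, AddChar.map_add_eq_mul]
    ring
  refine ⟨α, j, hα, fun r => ?_⟩
  have := congrFun hzero (t * r)
  simpa only [Units.inv_mul_cancel_left, Pi.zero_apply, sub_eq_zero] using this

theorem exists_twist {a m : ℕ} (ha : a ≠ 0) (hm : Odd m) {f : ZMod (2 ^ a) → ℂ}
    (hf : ∀ i, f i ^ (2 * m) = 1) (corr : ∀ k, k ≠ 0 → ∑ i, f (i + k) * (f i)⁻¹ = 0)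
    (t : (ZMod (2 ^ a))ˣ) :
    ∃ (α : ℂ) (j : ZMod (2 ^ a)), α ^ m = 1 ∧ ∀ r, f r - f (r + 2 ^ (a - 1)) =
      α * (f (t * r - j) - f (t * r - j + 2 ^ (a - 1))) := by
  have hN : NeZero (2 ^ a * m) := ⟨mul_ne_zero (by positivity) hm.pos.ne'⟩
  have hNQ : NeZero ((2 ^ a * m : ℕ) : ℚ) := ⟨Nat.cast_ne_zero.mpr hN.ne⟩
  have : IsCyclotomicExtension {2 ^ a * m} ℚ (CyclotomicField (2 ^ a * m) ℚ) :=
    CyclotomicField.isCyclotomicExtension _ _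
  have hζ := IsCyclotomicExtension.zeta_spec (2 ^ a * m) ℚ (CyclotomicField (2 ^ a * m) ℚ)
  obtain ⟨φ⟩ : Nonempty (CyclotomicField (2 ^ a * m) ℚ →+* ℂ) := inferInstance
  have hlift : ∀ i, ∃ g, φ g = f i := by
    intro i
    obtain ⟨c, hc⟩ : 2 * m ∣ 2 ^ a * m := Nat.mul_dvd_mul_right (dvd_pow_self 2 ha) m
    obtain ⟨e, -, he⟩ := (hζ.map_of_injective φ.injective).eq_pow_of_pow_eq_one (ξ := f i)
      (by rw [hc, pow_mul, hf, one_pow])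
    exact ⟨_, (map_pow φ _ e).trans he⟩
  choose g hg using hlift
  obtain ⟨α, j, hα, h⟩ := IsCyclotomicExtension.Rat.exists_twist ha hm (g := g)
    (fun i => φ.injective (by rw [map_pow, hg, hf, map_one]))
    (fun k hk => φ.injective (by simp [hg, corr k hk])) t
  refine ⟨φ α, j, by rw [← map_pow, hα, map_one], fun r => ?_⟩
  simpa only [map_sub, map_mul, hg] using congrArg φ (h r)

/-- The energy of the odd part of a perfect unimodular sequence. -/
theorem sum_norm_sub_sq_of_perfect {G : Type*} [AddCommGroup G] [Fintype G] {f : G → ℂ}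
    (hf : ∀ i, ‖f i‖ = 1) {k : G} (hk : k + k = 0) (corr : ∑ i, f (i + k) * (f i)⁻¹ = 0) :
    ∑ i, ‖f i - f (i + k)‖ ^ 2 = 2 * Fintype.card G := by
  have corr' : ∑ i, f i * (f (i + k))⁻¹ = 0 := by
    rw [← Equiv.sum_comp (Equiv.addRight k)]
    simpa [add_assoc, hk] using corr
  have h1 : ∀ i, f i * (f i)⁻¹ = 1 := fun i =>
    mul_inv_cancel₀ (norm_ne_zero_iff.mp (by rw [hf]; exact one_ne_zero))
  have h2 : ∀ i, ((‖f i - f (i + k)‖ ^ 2 : ℝ) : ℂ) =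
      2 - f (i + k) * (f i)⁻¹ - f i * (f (i + k))⁻¹ := by
    intro i
    rw [← Complex.normSq_eq_norm_sq, ← Complex.mul_conj, map_sub, ← Complex.inv_eq_conj (hf _),
      ← Complex.inv_eq_conj (hf _)]
    linear_combination h1 i + h1 (i + k)
  have : ((∑ i, ‖f i - f (i + k)‖ ^ 2 : ℝ) : ℂ) = ((2 * Fintype.card G : ℝ) : ℂ) := by
    rw [Complex.ofReal_sum]
    simp_rw [h2, Finset.sum_sub_distrib, corr, corr']
    simp [mul_comm]
  exact_mod_cast this

theorem norm_sub_sq_le_four {E : Type*} [SeminormedAddCommGroup E] {x y : E} (hx : ‖x‖ = 1)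
    (hy : ‖y‖ = 1) : ‖x - y‖ ^ 2 ≤ 4 := by
  have := norm_sub_le x y
  nlinarith [norm_nonneg (x - y)]

theorem eq_neg_of_norm_sub_sq_eq_four {x y : ℂ} (hx : ‖x‖ = 1) (hy : ‖y‖ = 1)
    (h : ‖x - y‖ ^ 2 = 4) : y = -x := by
  have := parallelogram_law_with_norm ℝ x y
  rw [hx, hy] at this
  have h0 : ‖x + y‖ = 0 := by nlinarith
  exact (neg_eq_of_add_eq_zero_right (norm_eq_zero.mp h0)).symm

/-- A function that is twisted-invariant under `T` and antiperiodic vanishes at every point whose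
orbit meets its antipode. -/
theorem eq_zero_of_iterate_eq_add {G : Type*} [AddCommGroup G] {c : G → ℂ} {T : G → G} {k : G}
    {α : ℂ} {m : ℕ} (hm : Odd m) (hα : α ^ m = 1) (hT : ∀ r, c r = α * c (T r))
    (hk : ∀ r, c (r + k) = -c r) {r : G} {i : ℕ} (hi : T^[i] r = r + k) : c r = 0 := by
  have iter : ∀ i r, c r = α ^ i * c (T^[i] r) := by
    intro i
    induction i with
    | zero => simp
    | succ i ih =>
      intro r
      rw [Function.iterate_succ_apply, pow_succ', mul_assoc, ← ih, ← hT]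
  have h := iter i r
  rw [hi, hk] at h
  have h' : (1 + α ^ i) * c r = 0 := by linear_combination h
  refine (mul_eq_zero.mp h').resolve_left fun h0 => ?_
  have h1 : (α ^ i) ^ m = 1 := by rw [pow_right_comm, hα, one_pow]
  rw [eq_neg_of_add_eq_zero_right h0, hm.neg_one_pow] at h1
  norm_num at h1

/-- There is no perfect sequence of length `16` whose entries have order twice an odd number. -/
theorem not_perfect_sixteen {m : ℕ} (hm : Odd m) {f : ZMod 16 → ℂ}
    (hf : ∀ i, f i ^ (2 * m) = 1) (corr : ∀ k, k ≠ 0 → ∑ i, f (i + k) * (f i)⁻¹ = 0) : False := by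
  have hnorm : ∀ i, ‖f i‖ = 1 := fun i =>
    Complex.norm_eq_one_of_pow_eq_one (hf i) (mul_ne_zero two_ne_zero hm.pos.ne')
  obtain ⟨α, j, hα, h⟩ := exists_twist (a := 4) (by norm_num) hm hf corr
    (⟨5, 13, by decide, by decide⟩ : (ZMod 16)ˣ)
  change ∀ r : ZMod 16, f r - f (r + 8) = α * (f (5 * r - j) - f (5 * r - j + 8)) at h
  have key : ∀ j : ZMod 16, ∃ s : ZMod 16, ∀ r : ZMod 16, r ∉ ({0, 4, 8, 12} : Finset (ZMod 16)) →
      ∃ i : Fin 16, (fun r => 5 * r - j)^[i] (r + s) = r + s + 8 := by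
    decide
  obtain ⟨s, hs⟩ := key j
  have hzero : ∀ r, r ∉ ({0, 4, 8, 12} : Finset (ZMod 16)) → f (r + s) - f (r + s + 8) = 0 := by
    intro r hr
    obtain ⟨i, hi⟩ := hs r hr
    refine eq_zero_of_iterate_eq_add (c := fun r => f r - f (r + 8)) hm hα h (fun r => ?_) hi
    rw [add_assoc, show (8 : ZMod 16) + 8 = 0 by decide, add_zero, neg_sub]
  have hsum := sum_norm_sub_sq_of_perfect hnorm (k := 8) (by decide) (corr 8 (by decide))
  rw [← Equiv.sum_comp (Equiv.addRight s),
    ← Finset.sum_subset (Finset.subset_univ ({0, 4, 8, 12} : Finset (ZMod 16)))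
      (fun r _ hr => by simp [hzero r hr])] at hsum
  have hle := Finset.sum_le_card_nsmul ({0, 4, 8, 12} : Finset (ZMod 16))
    (fun r => ‖f (Equiv.addRight s r) - f (Equiv.addRight s r + 8)‖ ^ 2) 4
    fun r _ => norm_sub_sq_le_four (hnorm _) (hnorm _)
  rw [hsum, ZMod.card, show ({0, 4, 8, 12} : Finset (ZMod 16)).card = 4 by decide] at hle
  norm_num at hle

/-- There is no perfect sequence of length `8` whose entries have order twice an odd number. -/
theorem not_perfect_eight {m : ℕ} (hm : Odd m) {f : ZMod 8 → ℂ}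
    (hf : ∀ i, f i ^ (2 * m) = 1) (corr : ∀ k, k ≠ 0 → ∑ i, f (i + k) * (f i)⁻¹ = 0) : False := by
  have hnorm : ∀ i, ‖f i‖ = 1 := fun i =>
    Complex.norm_eq_one_of_pow_eq_one (hf i) (mul_ne_zero two_ne_zero hm.pos.ne')
  obtain ⟨α, j, hα, h⟩ := exists_twist (a := 3) (by norm_num) hm hf corr
    (⟨5, 5, by decide, by decide⟩ : (ZMod 8)ˣ)
  change ∀ r : ZMod 8, f r - f (r + 4) = α * (f (5 * r - j) - f (5 * r - j + 4)) at h
  have key : ∀ j : ZMod 8, ∃ s : ZMod 8, ∀ r : ZMod 8, r ∉ ({0, 2, 4, 6} : Finset (ZMod 8)) →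
      ∃ i : Fin 8, (fun r => 5 * r - j)^[i] (r + s) = r + s + 4 := by
    decide
  obtain ⟨s, hs⟩ := key j
  have hzero : ∀ r, r ∉ ({0, 2, 4, 6} : Finset (ZMod 8)) → f (r + s) - f (r + s + 4) = 0 := by
    intro r hr
    obtain ⟨i, hi⟩ := hs r hr
    refine eq_zero_of_iterate_eq_add (c := fun r => f r - f (r + 4)) hm hα h (fun r => ?_) hi
    rw [add_assoc, show (4 : ZMod 8) + 4 = 0 by decide, add_zero, neg_sub]
  have hsum := sum_norm_sub_sq_of_perfect hnorm (k := 4) (by decide) (corr 4 (by decide))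
  rw [← Equiv.sum_comp (Equiv.addRight s),
    ← Finset.sum_subset (Finset.subset_univ ({0, 2, 4, 6} : Finset (ZMod 8)))
      (fun r _ hr => by simp [hzero r hr])] at hsum
  have hle : ∀ r ∈ ({0, 2, 4, 6} : Finset (ZMod 8)),
      ‖f (Equiv.addRight s r) - f (Equiv.addRight s r + 4)‖ ^ 2 ≤ 4 :=
    fun r _ => norm_sub_sq_le_four (hnorm _) (hnorm _)
  have heq := (Finset.sum_eq_sum_iff_of_le hle).mp (by
    rw [hsum, ZMod.card, Finset.sum_const,
      show ({0, 2, 4, 6} : Finset (ZMod 8)).card = 4 by decide]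
    norm_num)
  have hneg : ∀ r ∈ ({0, 2, 4, 6} : Finset (ZMod 8)), f (r + s + 4) = -f (r + s) :=
    fun r hr => eq_neg_of_norm_sub_sq_eq_four (hnorm _) (hnorm _) (heq r hr)
  obtain ⟨F, hF⟩ : ∃ F : ZMod 8 → ℂ, ∀ i, F i = f (i + s) := ⟨_, fun _ => rfl⟩
  have hF4 : F 4 = -F 0 := by
    rw [hF, hF, ← hneg 0 (by decide), add_right_comm]
    rfl
  have hF6 : F 6 = -F 2 := by
    rw [hF, hF, ← hneg 2 (by decide), add_right_comm]
    rfl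
  have hF5 : F 5 = F 1 := by
    rw [hF, hF, sub_eq_zero.mp (hzero 1 (by decide)), add_right_comm]
    rfl
  have hF7 : F 7 = F 3 := by
    rw [hF, hF, sub_eq_zero.mp (hzero 3 (by decide)), add_right_comm]
    rfl
  have hcorr : ∑ i, F (i + 2) * (F i)⁻¹ = 0 := by
    refine Eq.trans ?_ ((Equiv.sum_comp (Equiv.addRight s) fun i => f (i + 2) * (f i)⁻¹).trans
      (corr 2 (by decide)))
    refine Finset.sum_congr rfl fun i _ => ?_
    rw [hF, hF, Equiv.coe_addRight, add_right_comm]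
  have hexp : ∑ i, F (i + 2) * (F i)⁻¹ = F 2 * (F 0)⁻¹ + F 3 * (F 1)⁻¹ + F 4 * (F 2)⁻¹ +
      F 5 * (F 3)⁻¹ + F 6 * (F 4)⁻¹ + F 7 * (F 5)⁻¹ + F 0 * (F 6)⁻¹ + F 1 * (F 7)⁻¹ :=
    Fin.sum_univ_eight _
  rw [hcorr, hF4, hF5, hF6, hF7] at hexp
  have ha : ‖F 2 * (F 0)⁻¹‖ = 1 := by simp [hF, hnorm]
  have hb : ‖F 3 * (F 1)⁻¹‖ = 1 := by simp [hF, hnorm]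
  have hb' : (F 3 * (F 1)⁻¹) ^ (2 * m) = 1 := by
    rw [mul_pow, inv_pow, hF, hF, hf, hf, inv_one, one_mul]
  have hrel : F 2 * (F 0)⁻¹ - (F 2 * (F 0)⁻¹)⁻¹ + F 3 * (F 1)⁻¹ + (F 3 * (F 1)⁻¹)⁻¹ = 0 := by
    simp only [mul_inv, inv_inv, inv_neg] at hexp ⊢
    linear_combination (-1 / 2 : ℂ) * hexp
  generalize F 2 * (F 0)⁻¹ = x at *
  generalize F 3 * (F 1)⁻¹ = y at *
  rw [Complex.inv_eq_conj ha, Complex.inv_eq_conj hb] at hrel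
  have hre : y.re = 0 := by
    have := congrArg Complex.re hrel
    simp only [Complex.add_re, Complex.sub_re, Complex.conj_re, Complex.zero_re] at this
    linarith
  have hyc : starRingEnd ℂ y = -y := by
    apply Complex.ext <;> simp [hre]
  have hy0 : y ≠ 0 := norm_ne_zero_iff.mp (by rw [hb]; exact one_ne_zero)
  have hy2 : y ^ 2 = -1 := by
    have h1 := mul_inv_cancel₀ hy0
    rw [Complex.inv_eq_conj hb, hyc] at h1
    linear_combination -h1
  rw [pow_mul, hy2, hm.neg_one_pow] at hb'
  norm_num at hb'

/-- The first column of a group-invariant Butson matrix is a perfect sequence. -/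
theorem IsBHMatrix.sum_eq_zero {G : Type} [AddCommGroup G] [Fintype G] [DecidableEq G]
    {H : Matrix G G ℂ} {h : ℕ} (hh : h ≠ 0) (hH : IsBHMatrix H h) {k : G} (hk : k ≠ 0) :
    ∑ i, H (i + k) 0 * (H i 0)⁻¹ = 0 := by
  obtain ⟨hroot, hinv, hmul⟩ := hH
  have h1 := congrFun (congrFun hmul k) 0
  rw [Matrix.mul_apply, Matrix.smul_apply, Matrix.one_apply_ne hk, smul_zero,
    ← Equiv.sum_comp (Equiv.neg G)] at h1
  rw [← h1]
  refine Finset.sum_congr rfl fun i _ => ?_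
  rw [Matrix.conjTranspose_apply, Equiv.neg_apply, ← hinv k (-i) i, ← hinv 0 (-i) i,
    neg_add_cancel, zero_add, add_comm k,
    Complex.inv_eq_conj (Complex.norm_eq_one_of_pow_eq_one (hroot _ _) hh)]
  rfl

/-- Let `a ∈ {3, 4}` and let `h` be a positive integer with `ν_2(h) = 1`
(i.e. `h ≡ 2 (mod 4)`).  Then no `BH(ℤ_{2^a}, h)` matrix exists. -/
theorem statement10
    (a h : ℕ) (hA : a = 3 ∨ a = 4) (hh : 0 < h) (hval : padicValNat 2 h = 1) :
    ¬ ∃ H : Matrix (ZMod (2 ^ a)) (ZMod (2 ^ a)) ℂ, IsBHMatrix H h := by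
  rintro ⟨H, hH⟩
  obtain ⟨m, hm, rfl⟩ : ∃ m, Odd m ∧ h = 2 * m := by
    obtain ⟨m, rfl⟩ : 2 ∣ h := dvd_of_one_le_padicValNat hval.ge
    refine ⟨m, Nat.not_even_iff_odd.mp fun hev => ?_, rfl⟩
    have h4 : 2 ^ 2 ∣ 2 * m := Nat.mul_dvd_mul_left 2 hev.two_dvd
    have := (padicValNat_dvd_iff_le hh.ne').mp h4
    omega
  have hroot := fun i => hH.1 i 0
  have hcorr := fun k (hk : k ≠ 0) => hH.sum_eq_zero hh.ne' hk
  rcases hA with rfl | rfl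
  · exact not_perfect_eight hm hroot hcorr
  · exact not_perfect_sixteen hm hroot hcorr
end

section
/- Let G = ℤ_{p_1^{a_1}} × ⋯ × ℤ_{p_s^{a_s}}, where p_1,…,p_s are (not necessarily distinct) primes and a_1,…,a_s positive integers, identified with the set of tuples (g_1,…,g_s) with 0 ≤ g_i ≤ p_i^{a_i} − 1 under componentwise addition, the i-th component taken modulo p_i^{a_i}. Let e = exp(G) and define f : G × G → ℤ_e by f((g_1,…,g_s),(h_1,…,h_s)) = ∑_{i=1}^{s} (e / p_i^{a_i}) g_i h_i (mod e). Let U = { (p_1^{⌊a_1/2⌋} k_1, …, p_s^{⌊a_s/2⌋} k_s) : 0 ≤ k_i ≤ p_i^{⌈a_i/2⌉} − 1 }. Then: (1) f is a symmetric bilinear form on G with values in ℤ_e; (2) f is nondegenerate, i.e., for every nonzero g ∈ G there exists t ∈ G with f(g,t) ≠ 0; and (3) every element g ∈ G satisfying f(g,u) = 0 for all u ∈ U lies in U. -/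
open scoped BigOperators

theorem ZMod.natCast_div_mul_eq_of_modEq {n e x y : ℕ} (hn : n ∣ e) (h : x ≡ y [MOD n]) :
    ((e / n * x : ℕ) : ZMod e) = ((e / n * y : ℕ) : ZMod e) := by
  rw [ZMod.natCast_eq_natCast_iff]
  simpa only [Nat.div_mul_cancel hn] using h.mul_left' (e / n)

theorem ZMod.natCast_div_mul_eq_zero_iff {n e x : ℕ} (hn : n ∣ e) (he : 0 < e) :
    ((e / n * x : ℕ) : ZMod e) = 0 ↔ n ∣ x := by
  rw [ZMod.natCast_eq_zero_iff]
  have hc : 0 < e / n := Nat.div_pos (Nat.le_of_dvd he hn) (Nat.pos_of_dvd_of_pos hn he)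
  conv_lhs => rw [← Nat.div_mul_cancel hn, Nat.mul_div_cancel _ (Nat.pos_of_dvd_of_pos hn he)]
  exact Nat.mul_dvd_mul_iff_left hc

theorem ZMod.dvd_exponent_pi {ι : Type*} (n : ι → ℕ) (i : ι) :
    n i ∣ AddMonoid.exponent (∀ i, ZMod (n i)) := by
  have h := AddMonoidHom.exponent_dvd (f := Pi.evalAddMonoidHom (fun i => ZMod (n i)) i)
    (Function.surjective_eval i)
  rwa [ZMod.exponent] at h

/-- the ingredients used in Corollary 2.3 of the paper.
Let `G = ℤ_{p_1^{a_1}} × ⋯ × ℤ_{p_s^{a_s}}`, `e = exp(G)`, let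
`f((g_i), (h_i)) = ∑_i (e / p_i^{a_i}) g_i h_i (mod e)`, and let
`U = {(p_i^{⌊a_i/2⌋} k_i)_i : k_i ∈ ℕ}`.  Then `f` is a symmetric bilinear form on `G`
with values in `ℤ_e`, `f` is nondegenerate, and every `g ∈ G` orthogonal to all of `U`
lies in `U`. -/
theorem statement11
    (s : ℕ) (p a : Fin s → ℕ) (hp : ∀ i, (p i).Prime) (ha : ∀ i, 0 < a i)
    (e : ℕ) (he : e = AddMonoid.exponent (∀ i : Fin s, ZMod (p i ^ a i)))
    (f : (∀ i : Fin s, ZMod (p i ^ a i)) → (∀ i : Fin s, ZMod (p i ^ a i)) → ZMod e)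
    (hf : ∀ g h : ∀ i : Fin s, ZMod (p i ^ a i),
      f g h = ((∑ i : Fin s, (e / p i ^ a i) * (g i).val * (h i).val : ℕ) : ZMod e))
    (U : Set (∀ i : Fin s, ZMod (p i ^ a i)))
    (hU : U = {g : ∀ i : Fin s, ZMod (p i ^ a i) |
      ∀ i : Fin s, ∃ k : ℕ, g i = ((p i ^ (a i / 2) * k : ℕ) : ZMod (p i ^ a i))}) :
    (∀ g h k : ∀ i : Fin s, ZMod (p i ^ a i),
        f (g + h) k = f g k + f h k ∧ f g (h + k) = f g h + f g k ∧ f g h = f h g) ∧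
    (∀ g : ∀ i : Fin s, ZMod (p i ^ a i), g ≠ 0 → ∃ t, f g t ≠ 0) ∧
    (∀ g : ∀ i : Fin s, ZMod (p i ^ a i), (∀ u ∈ U, f g u = 0) → g ∈ U) := by
  have hdvd : ∀ i, p i ^ a i ∣ e := fun i => he ▸ ZMod.dvd_exponent_pi (fun i => p i ^ a i) i
  have hne : ∀ i, NeZero (p i ^ a i) := fun i => ⟨pow_ne_zero _ (hp i).ne_zero⟩
  have hpos : 0 < e := by
    rw [he]
    exact Nat.pos_of_ne_zero AddMonoid.exponent_ne_zero_of_finite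
  have hsymm : ∀ g h, f g h = f h g := fun g h => by
    simp only [hf, mul_assoc, mul_comm (g _).val]
  have hadd : ∀ g h k, f (g + h) k = f g k + f h k := fun g h k => by
    simp only [hf, Nat.cast_sum, ← Finset.sum_add_distrib]
    refine Finset.sum_congr rfl fun i _ => ?_
    rw [← Nat.cast_add, mul_assoc, mul_assoc, mul_assoc, ← mul_add, ← add_mul]
    refine ZMod.natCast_div_mul_eq_of_modEq (hdvd i) (Nat.ModEq.mul_right _ ?_)
    rw [Pi.add_apply, ZMod.val_add]
    exact Nat.mod_modEq _ _
  have hsingle : ∀ g i (m : ℕ),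
      f g (Pi.single i (m : ZMod (p i ^ a i))) = 0 ↔ p i ^ a i ∣ (g i).val * m := fun g i m => by
    rw [hf, Finset.sum_eq_single i (fun j _ hj => by simp [hj]) (by simp), Pi.single_eq_same,
      mul_assoc, ZMod.natCast_div_mul_eq_zero_iff (hdvd i) hpos, ZMod.val_natCast]
    exact ((Nat.mod_modEq _ _).mul_left _).dvd_iff dvd_rfl
  refine ⟨fun g h k => ⟨hadd g h k, ?_, hsymm g h⟩, fun g hg => ?_, fun g hg => ?_⟩
  · rw [hsymm, hadd, hsymm h, hsymm k]
  · obtain ⟨i, hi⟩ := Function.ne_iff.mp hg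
    refine ⟨Pi.single i ((1 : ℕ) : ZMod (p i ^ a i)), fun h => hi ?_⟩
    rw [hsingle, mul_one, ← ZMod.natCast_eq_zero_iff, ZMod.natCast_zmod_val] at h
    exact h
  · subst hU
    intro i
    have hmem := hg (Pi.single i ((p i ^ (a i / 2) : ℕ) : ZMod (p i ^ a i))) fun j => by
      rcases eq_or_ne j i with rfl | hj
      · exact ⟨1, by simp⟩
      · exact ⟨0, by simp [hj]⟩
    rw [hsingle] at hmem
    have hle : p i ^ (a i / 2) * p i ^ (a i / 2) ∣ p i ^ a i := by
      rw [← pow_add]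
      exact pow_dvd_pow _ (by omega)
    obtain ⟨k, hk⟩ :=
      Nat.dvd_of_mul_dvd_mul_right (pow_pos (hp i).pos _) (hle.trans hmem)
    exact ⟨k, by rw [← hk, ZMod.natCast_zmod_val]⟩
end
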